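/- arXiv:math/0612219 — 3 statements merged into one kernel-verified Lean document; each statement's English description precedes it below -/
import Mathlib

section
/- Let C be a support tilting object in rep Q. Then Gen C is a torsion class, and the indecomposable Ext-projective objects of Gen C are exactly the indecomposable direct summands of C; in particular, the basic module associated to C is the direct sum of the indecomposable Ext-projectives of Gen C. -/
open CategoryTheory CategoryTheory.Limits ZeroObject

attribute [local instance] CategoryTheory.Abelian.hasFiniteBiproducts

noncomputable section

namespace NCPaper

/-- A finite quiver without oriented cycles. -/
structure FinQuiver : Type 1 where
  V : Type
  [quiver : Quiver.{0} V]
  [fintypeV : Fintype V]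
  [fintypeArr : ∀ a b : V, Fintype (a ⟶ b)]
  acyclic : ∀ (v : V) (p : Quiver.Path v v), p = Quiver.Path.nil

attribute [instance] FinQuiver.quiver FinQuiver.fintypeV FinQuiver.fintypeArr

variable (k : Type) [Field k] (Q : FinQuiver)

/-- The ambient abelian category of all `k`-linear representations of `Q`;
finite-dimensional representations are singled out by the predicate `FinDim`. -/
abbrev RepC : Type 1 := Paths Q.V ⥤ ModuleCat.{0} k

variable {k Q}

/-- `M` is a finite-dimensional representation, i.e. an object of `rep Q`. -/
def FinDim (M : RepC k Q) : Prop :=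
  ∀ v : Q.V, FiniteDimensional k (M.obj ((Paths.of Q.V).obj v))

section Cat

variable {C : Type*} [Category C] [Abelian C]

/-- `X` is a direct summand of `A`. -/
def IsSummand (X A : C) : Prop := ∃ (i : X ⟶ A) (r : A ⟶ X), i ≫ r = 𝟙 X

/-- The additive closure of a set of objects: direct summands of finite direct sums. -/
def addSet (S : Set C) : Set C :=
  { X | ∃ (n : ℕ) (f : Fin n → C), (∀ i, f i ∈ S) ∧ IsSummand X (⨁ f) }

/-- `Gen S`: all quotients of objects of the additive closure of `S`. -/
def gen (S : Set C) : Set C := { X | ∃ A ∈ addSet S, ∃ p : A ⟶ X, Epi p }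

/-- All morphisms from `A` to `B` vanish. -/
def HomZero (A B : C) : Prop := ∀ f : A ⟶ B, f = 0

/-- `Ext¹(A, B) = 0`, expressed by the splitting of all short exact sequences
`0 ⟶ B ⟶ E ⟶ A ⟶ 0`. -/
def Ext1Zero (A B : C) : Prop :=
  ∀ (E : C) (i : B ⟶ E) (p : E ⟶ A) (w : i ≫ p = 0),
    (ShortComplex.mk i p w).ShortExact → ∃ r : E ⟶ B, i ≫ r = 𝟙 B

/-- An indecomposable object. -/
def Indec (X : C) : Prop :=
  ¬ IsZero X ∧ ∀ (A B : C), (X ≅ A ⊞ B) → IsZero A ∨ IsZero B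

/-- A torsion class: a full subcategory (identified with its set of objects) closed under
direct sums, direct summands, quotients and extensions. -/
structure IsTorsionClass (T : Set C) : Prop where
  zero_mem : (0 : C) ∈ T
  sum_mem : ∀ X ∈ T, ∀ Y ∈ T, (X ⊞ Y : C) ∈ T
  summand_mem : ∀ X ∈ T, ∀ Y : C, IsSummand Y X → Y ∈ T
  quot_mem : ∀ X ∈ T, ∀ (Y : C) (p : X ⟶ Y), Epi p → Y ∈ T
  ext_mem : ∀ S : ShortComplex C, S.ShortExact → S.X₁ ∈ T → S.X₃ ∈ T → S.X₂ ∈ T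

/-- A wide subcategory: a full subcategory (closed under direct sums and summands)
which is exact abelian (closed under kernels and cokernels) and closed under extensions. -/
structure IsWide (A : Set C) : Prop where
  zero_mem : (0 : C) ∈ A
  sum_mem : ∀ X ∈ A, ∀ Y ∈ A, (X ⊞ Y : C) ∈ A
  summand_mem : ∀ X ∈ A, ∀ Y : C, IsSummand Y X → Y ∈ A
  ker_mem : ∀ X ∈ A, ∀ Y ∈ A, ∀ f : X ⟶ Y, (kernel f : C) ∈ A
  coker_mem : ∀ X ∈ A, ∀ Y ∈ A, ∀ f : X ⟶ Y, (cokernel f : C) ∈ A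
  ext_mem : ∀ S : ShortComplex C, S.ShortExact → S.X₁ ∈ A → S.X₃ ∈ A → S.X₂ ∈ A

/-- `P` is split projective in the subcategory `T`: every epimorphism onto `P`
from an object of `T` splits. -/
def SplitProjIn (T : Set C) (P : C) : Prop :=
  P ∈ T ∧ ∀ X ∈ T, ∀ p : X ⟶ P, Epi p → ∃ s : P ⟶ X, s ≫ p = 𝟙 P

/-- `P` is Ext-projective in the subcategory `T`. -/
def ExtProjIn (T : Set C) (P : C) : Prop := P ∈ T ∧ ∀ X ∈ T, Ext1Zero P X

/-- The subcategory `a(T)` associated to a torsion class `T`. -/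
def aSet (T : Set C) : Set C :=
  { B | B ∈ T ∧ ∀ Y ∈ T, ∀ g : Y ⟶ B, (kernel g : C) ∈ T }

/-- A subcategory is finitely generated if it is generated by a single object of it. -/
def IsFinGen (T : Set C) : Prop := ∃ U ∈ T, T ⊆ gen {U}

/-- `U` is a generator of the subcategory `T`. -/
def IsGenerator (T : Set C) (U : C) : Prop := U ∈ T ∧ T ⊆ gen {U}

/-- `X` is a subquotient of `M`. -/
def IsSubquotient (X M : C) : Prop := ∃ (N : C) (i : N ⟶ M) (p : N ⟶ X), Mono i ∧ Epi p

/-- The support of `M` is contained in the support of `C0`: every simple subquotient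
(composition factor) of `M` is a composition factor of `C0`. -/
def SuppLE (M C0 : C) : Prop := ∀ S : C, Simple S → IsSubquotient S M → IsSubquotient S C0

/-- A partial tilting object of a hereditary category. -/
def IsPartialTilting (T : C) : Prop := Ext1Zero T T

/-- `T` is a tilting object of the full subcategory `A`: it is self-orthogonal and every
(split) projective object of `A` admits a coresolution `0 ⟶ P ⟶ T' ⟶ T'' ⟶ 0` with
`T', T'' ∈ add T`. For `A` the subcategory of representations supported on `supp T`,
this says exactly that `T` is a tilting `kQ/ann T`-module. -/
def TiltingIn (A : Set C) (T : C) : Prop :=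
  T ∈ A ∧ Ext1Zero T T ∧
    ∀ P : C, SplitProjIn A P →
      ∃ (T' T'' : C) (_ : T' ∈ addSet {T}) (_ : T'' ∈ addSet {T})
        (i : P ⟶ T') (p : T' ⟶ T'') (w : i ≫ p = 0),
        (ShortComplex.mk i p w).ShortExact


/-- `U` is the direct sum of one representative of each isomorphism class of
indecomposable Ext-projective objects of `T`. -/
def IsExtProjSum (T : Set C) (U : C) : Prop :=
  ∃ (n : ℕ) (f : Fin n → C),
    (∀ i, Indec (f i) ∧ ExtProjIn T (f i)) ∧
    (∀ i j, Nonempty (f i ≅ f j) → i = j) ∧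
    (∀ P : C, Indec P → ExtProjIn T P → ∃ i, Nonempty (P ≅ f i)) ∧
    Nonempty (U ≅ ⨁ f)

/-- A basic object: a direct sum of pairwise non-isomorphic indecomposables. -/
def IsBasic (U : C) : Prop :=
  ∃ (n : ℕ) (f : Fin n → C), (∀ i, Indec (f i)) ∧
    (∀ i j, Nonempty (f i ≅ f j) → i = j) ∧ Nonempty (U ≅ ⨁ f)

end Cat

/-- A support tilting object of `rep Q`: partial tilting, and tilting as a
`kQ/ann T`-module, i.e. tilting in the subcategory of all finite-dimensional
representations supported on the support of `T`. -/
def IsSupportTilting {k : Type} [Field k] {Q : FinQuiver} (T : RepC k Q) : Prop :=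
  IsPartialTilting T ∧ TiltingIn { M : RepC k Q | FinDim M ∧ SuppLE M T } T

section Comb

/-- The dimension vector of a representation. -/
def dimVec {k : Type} [Field k] {Q : FinQuiver} (M : RepC k Q) : Q.V → ℤ :=
  fun v => (Module.finrank k (M.obj ((Paths.of Q.V).obj v)) : ℤ)

/-- The Euler form of the quiver `Q`. -/
def euler (Q : FinQuiver) {R : Type} [CommRing R] (α β : Q.V → R) : R :=
  (∑ v : Q.V, α v * β v) - ∑ a : (Σ x : Q.V, Σ y : Q.V, x ⟶ y), α a.1 * β a.2.1

/-- The symmetrized Euler form of the quiver `Q`. -/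
def symEuler (Q : FinQuiver) {R : Type} [CommRing R] (α β : Q.V → R) : R :=
  euler Q α β + euler Q β α

/-- The reflection in the vector `v`: `s_v(w) = w - (v, w)·v`. -/
def reflV (Q : FinQuiver) (v : Q.V → ℤ) : (Q.V → ℤ) → (Q.V → ℤ) :=
  fun w => w - symEuler Q v w • v

/-- The composition (product, written from left to right) of a finite sequence of
linear transformations. -/
def comps (Q : FinQuiver) {m : ℕ} (g : Fin m → ((Q.V → ℤ) → (Q.V → ℤ))) :
    (Q.V → ℤ) → (Q.V → ℤ) :=
  (List.ofFn g).foldr (· ∘ ·) id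

open scoped Classical in
/-- The simple root at a vertex. -/
def simRoot (Q : FinQuiver) (v : Q.V) : Q.V → ℤ := fun w => if w = v then 1 else 0

/-- The simple reflection at a vertex. -/
def sref (Q : FinQuiver) (v : Q.V) : (Q.V → ℤ) → (Q.V → ℤ) := reflV Q (simRoot Q v)

/-- An enumeration of the vertices is compatible with the arrows of `Q` if sources
of arrows come before targets. -/
def OrdCompatible (Q : FinQuiver) (ord : Fin (Fintype.card Q.V) ≃ Q.V) : Prop :=
  ∀ (x y : Q.V), (x ⟶ y) → ord.symm x < ord.symm y

/-- The Coxeter element `cox(Q)`: the product of the simple reflections from left to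
right in an order compatible with the arrows of `Q`. -/
def coxeter (Q : FinQuiver) (ord : Fin (Fintype.card Q.V) ≃ Q.V) :
    (Q.V → ℤ) → (Q.V → ℤ) :=
  comps Q fun i => sref Q (ord i)

/-- The product of the simple reflections indexed by a word (a list of vertices). -/
def wordProd (Q : FinQuiver) (l : List Q.V) : (Q.V → ℤ) → (Q.V → ℤ) :=
  (l.map (sref Q)).foldr (· ∘ ·) id

/-- Membership in the Coxeter group `W` (realized faithfully on the root lattice). -/
def InW (Q : FinQuiver) (w : (Q.V → ℤ) → (Q.V → ℤ)) : Prop :=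
  ∃ l : List Q.V, w = wordProd Q l

/-- The reflections of `W`: the conjugates of the simple reflections. -/
def IsRefl (Q : FinQuiver) (t : (Q.V → ℤ) → (Q.V → ℤ)) : Prop :=
  ∃ (l : List Q.V) (i : Q.V), t = wordProd Q l ∘ sref Q i ∘ wordProd Q l.reverse

/-- The absolute length: the least length of an expression as a product of reflections. -/
def ellT (Q : FinQuiver) (w : (Q.V → ℤ) → (Q.V → ℤ)) : ℕ :=
  sInf { m | ∃ f : Fin m → ((Q.V → ℤ) → (Q.V → ℤ)), (∀ i, IsRefl Q (f i)) ∧ w = comps Q f }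

/-- The absolute order on `W`. -/
def absLe (Q : FinQuiver) : ((Q.V → ℤ) → (Q.V → ℤ)) → ((Q.V → ℤ) → (Q.V → ℤ)) → Prop :=
  Relation.ReflTransGen fun u v => ∃ t, IsRefl Q t ∧ v = u ∘ t ∧ ellT Q v = ellT Q u + 1

/-- The noncrossing partitions `NC_Q`: the interval `[e, cox(Q)]` in absolute order. -/
def NCSet (Q : FinQuiver) (ord : Fin (Fintype.card Q.V) ≃ Q.V) :
    Set ((Q.V → ℤ) → (Q.V → ℤ)) :=
  { w | InW Q w ∧ absLe Q w (coxeter Q ord) }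

/-- `Q` is of finite (Dynkin) type: the symmetrized Euler form is positive definite. -/
def FiniteType (Q : FinQuiver) : Prop :=
  ∀ α : Q.V → ℚ, α ≠ 0 → 0 < symEuler Q α α

/-- `Q` is of affine (extended Dynkin) type: the symmetrized Euler form is positive
semidefinite with nontrivial radical. -/
def AffineType (Q : FinQuiver) : Prop :=
  (∀ α : Q.V → ℚ, 0 ≤ symEuler Q α α) ∧ ∃ α : Q.V → ℚ, α ≠ 0 ∧ symEuler Q α α = 0

end Comb

section Helpers

/-- the vector space at a vertex -/
abbrev sp (M : RepC k Q) (v : Q.V) : ModuleCat.{0} k := M.obj ((Paths.of Q.V).obj v)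

/-- the map at an arrow -/
def mp (M : RepC k Q) {x y : Q.V} (a : x ⟶ y) : sp M x →ₗ[k] sp M y :=
  (M.map ((Paths.of Q.V).map a)).hom

/-- component of a morphism -/
def ap {M N : RepC k Q} (f : M ⟶ N) (v : Q.V) : sp M v →ₗ[k] sp N v :=
  (f.app ((Paths.of Q.V).obj v)).hom

theorem ap_comp {M N L : RepC k Q} (f : M ⟶ N) (g : N ⟶ L) (v : Q.V) (m : sp M v) :
    ap (f ≫ g) v m = ap g v (ap f v m) := by
  simp [ap]

theorem ap_id (M : RepC k Q) (v : Q.V) (m : sp M v) : ap (𝟙 M) v m = m := by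
  simp [ap]

theorem ap_zero (M N : RepC k Q) (v : Q.V) (m : sp M v) : ap (0 : M ⟶ N) v m = 0 := by
  simp [ap]

theorem ap_sum {ι : Type} (s : Finset ι) {M N : RepC k Q} (f : ι → (M ⟶ N)) (v : Q.V)
    (m : sp M v) : ap (∑ i ∈ s, f i) v m = ∑ i ∈ s, ap (f i) v m := by
  classical
  induction s using Finset.induction_on with
  | empty => simp [ap_zero]
  | insert i s hi ih => rw [Finset.sum_insert hi, Finset.sum_insert hi, ← ih]; simp [ap]

theorem ap_nat {M N : RepC k Q} (f : M ⟶ N) {x y : Q.V} (a : x ⟶ y) (m : sp M x) :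
    ap f y (mp M a m) = mp N a (ap f x m) := by
  have := f.naturality ((Paths.of Q.V).map a)
  have h2 := congrArg (fun t => t.hom m) this
  simpa [ap, mp] using h2

theorem ap_ext {M N : RepC k Q} {f g : M ⟶ N} (h : ∀ v m, ap f v m = ap g v m) : f = g := by
  apply NatTrans.ext
  funext v
  apply ModuleCat.hom_ext
  apply LinearMap.ext
  exact h v

/-- build a morphism from components -/
def mkHom {M N : RepC k Q} (h : ∀ v : Q.V, sp M v →ₗ[k] sp N v)
    (hn : ∀ {x y : Q.V} (a : x ⟶ y) (m : sp M x), h y (mp M a m) = mp N a (h x m)) : M ⟶ N :=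
  Paths.liftNatTrans (fun v => ModuleCat.ofHom (h v)) (by
    intro x y a
    apply ModuleCat.hom_ext
    apply LinearMap.ext
    exact hn a)

theorem ap_mkHom {M N : RepC k Q} (h : ∀ v : Q.V, sp M v →ₗ[k] sp N v)
    (hn : ∀ {x y : Q.V} (a : x ⟶ y) (m : sp M x), h y (mp M a m) = mp N a (h x m)) (v : Q.V) :
    ap (mkHom h hn) v = h v := rfl

theorem mono_iff {M N : RepC k Q} (f : M ⟶ N) : Mono f ↔ ∀ v, Function.Injective (ap f v) := by
  rw [NatTrans.mono_iff_mono_app]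
  constructor
  · intro h v
    exact (ModuleCat.mono_iff_injective _).1 (h _)
  · intro h v
    exact (ModuleCat.mono_iff_injective _).2 (h v)

theorem epi_iff {M N : RepC k Q} (f : M ⟶ N) : Epi f ↔ ∀ v, Function.Surjective (ap f v) := by
  rw [NatTrans.epi_iff_epi_app]
  constructor
  · intro h v
    exact (ModuleCat.epi_iff_surjective _).1 (h _)
  · intro h v
    exact (ModuleCat.epi_iff_surjective _).2 (h v)

theorem exact_pt {S : ShortComplex (RepC k Q)} (hS : S.ShortExact) (v : Q.V) (m : sp S.X₂ v)
    (hm : ap S.g v m = 0) : ∃ n : sp S.X₁ v, ap S.f v n = m := by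
  have h := hS.map_of_exact ((evaluation (Paths Q.V) (ModuleCat.{0} k)).obj ((Paths.of Q.V).obj v))
  have h2 := (ShortComplex.moduleCat_exact_iff _).1 h.exact
  exact h2 m hm

/-- vanishing of Ext in terms of cocycles -/
def Ext0 (C X : RepC k Q) : Prop :=
  ∀ d : ∀ x y : Q.V, (x ⟶ y) → (sp C x →ₗ[k] sp X y),
    ∃ h : ∀ v : Q.V, sp C v →ₗ[k] sp X v, ∀ (x y : Q.V) (a : x ⟶ y) (c : sp C x),
      d x y a c = mp X a (h x c) - h y (mp C a c)

theorem Ext0.of_epi {C X Y : RepC k Q} (h : Ext0 C X) (p : X ⟶ Y) (hp : Epi p) : Ext0 C Y := by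
  intro d
  have hs := (epi_iff p).1 hp
  choose s hs' using fun v => LinearMap.exists_rightInverse_of_surjective (ap p v)
    (LinearMap.range_eq_top.2 (hs v))
  obtain ⟨h', hh⟩ := h (fun x y a => (s y) ∘ₗ d x y a)
  refine ⟨fun v => ap p v ∘ₗ h' v, fun x y a c => ?_⟩
  have := congrArg (ap p y) (hh x y a c)
  have e := LinearMap.congr_fun (hs' y) (d x y a c)
  simp only [LinearMap.comp_apply, map_sub, ap_nat, LinearMap.id_apply] at this e ⊢
  rw [← this, e]

theorem Ext0.of_mono {C D X : RepC k Q} (h : Ext0 C X) (i : D ⟶ C) (hi : Mono i) : Ext0 D X := by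
  intro d
  have hs := (mono_iff i).1 hi
  choose s hs' using fun v => LinearMap.exists_leftInverse_of_injective (ap i v)
    (LinearMap.ker_eq_bot.2 (hs v))
  obtain ⟨h', hh⟩ := h (fun x y a => d x y a ∘ₗ s x)
  refine ⟨fun v => h' v ∘ₗ ap i v, fun x y a c => ?_⟩
  have := hh x y a (ap i x c)
  have e := LinearMap.congr_fun (hs' x) c
  simp only [LinearMap.comp_apply, ap_nat, LinearMap.id_apply] at this e ⊢
  rw [← this, e]

theorem ap_total {ι : Type} [Fintype ι] (f : ι → RepC k Q) (v : Q.V) (m : sp (⨁ f) v) :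
    ∑ i, ap (biproduct.ι f i) v (ap (biproduct.π f i) v m) = m := by
  have := congrArg (fun t => ap t v m) (biproduct.total (f := f))
  simp only [ap_sum, ap_comp, ap_id] at this
  exact this

theorem Ext0.biprod_right {C : RepC k Q} {n : ℕ} {f : Fin n → RepC k Q}
    (h : ∀ i, Ext0 C (f i)) : Ext0 C (⨁ f) := by
  intro d
  choose h' hh using fun i => h i (fun x y a => ap (biproduct.π f i) y ∘ₗ d x y a)
  refine ⟨fun v => ∑ i, ap (biproduct.ι f i) v ∘ₗ h' i v, fun x y a c => ?_⟩
  rw [← ap_total f y (d x y a c)]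
  simp only [LinearMap.sum_apply, LinearMap.comp_apply, map_sum, ← ap_nat, ← Finset.sum_sub_distrib,
    ← map_sub]
  refine Finset.sum_congr rfl fun i _ => ?_
  rw [← hh i x y a c]; rfl

theorem Ext0.biprod_left {C : RepC k Q} {n : ℕ} {f : Fin n → RepC k Q}
    (h : ∀ i, Ext0 (f i) C) : Ext0 (⨁ f) C := by
  intro d
  choose h' hh using fun i => h i (fun x y a => d x y a ∘ₗ ap (biproduct.ι f i) x)
  refine ⟨fun v => ∑ i, h' i v ∘ₗ ap (biproduct.π f i) v, fun x y a c => ?_⟩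
  conv_lhs => rw [← ap_total f x c]
  simp only [LinearMap.sum_apply, LinearMap.comp_apply, map_sum, ap_nat, ← Finset.sum_sub_distrib]
  refine Finset.sum_congr rfl fun i _ => ?_
  rw [← hh i x y a]; rfl

theorem Ext0.extend {S : ShortComplex (RepC k Q)} (hS : S.ShortExact) {K : RepC k Q}
    (h : Ext0 S.X₃ K) (g : S.X₁ ⟶ K) : ∃ g' : S.X₂ ⟶ K, S.f ≫ g' = g := by
  have hi := (mono_iff S.f).1 hS.mono_f
  have hp := (epi_iff S.g).1 hS.epi_g
  choose t ht using fun v => LinearMap.exists_leftInverse_of_injective (ap S.f v)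
    (LinearMap.ker_eq_bot.2 (hi v))
  choose s hs using fun v => LinearMap.exists_rightInverse_of_surjective (ap S.g v)
    (LinearMap.range_eq_top.2 (hp v))
  have ht' : ∀ v n, t v (ap S.f v n) = n := fun v n => LinearMap.congr_fun (ht v) n
  have hs' : ∀ v n, ap S.g v (s v n) = n := fun v n => LinearMap.congr_fun (hs v) n
  have hz : ∀ v n, ap S.g v (ap S.f v n) = 0 := fun v n => by
    rw [← ap_comp, S.zero, ap_zero]
  obtain ⟨h', hh⟩ := h (fun x y a =>
    (mp K a ∘ₗ ap g x ∘ₗ t x - ap g y ∘ₗ t y ∘ₗ mp S.X₂ a) ∘ₗ s x)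
  refine ⟨mkHom (fun v => ap g v ∘ₗ t v - h' v ∘ₗ ap S.g v) ?_, ?_⟩
  · intro x y a m
    obtain ⟨n, hn⟩ := exact_pt hS x (m - s x (ap S.g x m)) (by rw [map_sub, hs', sub_self])
    have hm : m = ap S.f x n + s x (ap S.g x m) := by rw [hn]; abel
    have h1 := hh x y a (ap S.g x m)
    simp only [LinearMap.comp_apply, LinearMap.sub_apply] at h1
    generalize s x (ap S.g x m) = u at hm h1
    simp only [LinearMap.comp_apply, LinearMap.sub_apply, map_sub, ap_nat] at h1 ⊢
    have e1 : mp K a (ap g x (t x m)) = mp K a (ap g x n) + mp K a (ap g x (t x u)) := by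
      conv_lhs => rw [hm]
      simp only [map_add, ht']
    have e2 : ap g y (t y (mp S.X₂ a m)) = mp K a (ap g x n) + ap g y (t y (mp S.X₂ a u)) := by
      conv_lhs => rw [hm]
      simp only [map_add, ht', ← ap_nat]
    rw [e1, e2, eq_sub_iff_add_eq, sub_add_eq_add_sub]
    rw [sub_eq_iff_eq_add] at h1
    rw [h1]; abel
  · apply ap_ext
    intro v m
    rw [ap_comp, ap_mkHom]
    simp [ht', hz]

theorem Ext0.lift {S : ShortComplex (RepC k Q)} (hS : S.ShortExact) {A : RepC k Q}
    (h : Ext0 A S.X₁) (g : A ⟶ S.X₃) : ∃ g' : A ⟶ S.X₂, g' ≫ S.g = g := by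
  have hi := (mono_iff S.f).1 hS.mono_f
  have hp := (epi_iff S.g).1 hS.epi_g
  choose t ht using fun v => LinearMap.exists_leftInverse_of_injective (ap S.f v)
    (LinearMap.ker_eq_bot.2 (hi v))
  choose s hs using fun v => LinearMap.exists_rightInverse_of_surjective (ap S.g v)
    (LinearMap.range_eq_top.2 (hp v))
  have ht' : ∀ v n, t v (ap S.f v n) = n := fun v n => LinearMap.congr_fun (ht v) n
  have hs' : ∀ v n, ap S.g v (s v n) = n := fun v n => LinearMap.congr_fun (hs v) n
  have hz : ∀ v n, ap S.g v (ap S.f v n) = 0 := fun v n => by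
    rw [← ap_comp, S.zero, ap_zero]
  obtain ⟨h', hh⟩ := h (fun x y a =>
    t y ∘ₗ (mp S.X₂ a ∘ₗ s x ∘ₗ ap g x - s y ∘ₗ ap g y ∘ₗ mp A a))
  refine ⟨mkHom (fun v => s v ∘ₗ ap g v - ap S.f v ∘ₗ h' v) ?_, ?_⟩
  · intro x y a m
    obtain ⟨n, hn⟩ := exact_pt hS y (mp S.X₂ a (s x (ap g x m)) - s y (ap g y (mp A a m)))
      (by simp only [map_sub, hs', ap_nat, sub_self])
    have h1 := congrArg (ap S.f y) (hh x y a m)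
    simp only [LinearMap.comp_apply, LinearMap.sub_apply] at h1 ⊢
    rw [← hn, ht', hn] at h1
    simp only [map_sub, ← ap_nat] at h1 ⊢
    rw [sub_eq_sub_iff_add_eq_add] at h1 ⊢
    rw [add_comm, ← add_comm (ap S.f y _), ← h1]
    abel
  · apply ap_ext
    intro v m
    rw [ap_comp, ap_mkHom]
    simp [hs', hz]

theorem ext1_of_ext0 {C X : RepC k Q} (h : Ext0 C X) : Ext1Zero C X := by
  intro E i p w hS
  exact Ext0.extend hS h (𝟙 X)

/-- the extension attached to a cocycle -/
def extRep (C X : RepC k Q) (d : ∀ x y : Q.V, (x ⟶ y) → (sp C x →ₗ[k] sp X y)) : RepC k Q :=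
  Paths.lift
    { obj := fun v => ModuleCat.of k (sp X v × sp C v)
      map := fun {x y} a => ModuleCat.ofHom
        (LinearMap.prod (mp X a ∘ₗ LinearMap.fst k _ _ + d x y a ∘ₗ LinearMap.snd k _ _)
          (mp C a ∘ₗ LinearMap.snd k _ _)) }

theorem mp_extRep (C X : RepC k Q) (d : ∀ x y : Q.V, (x ⟶ y) → (sp C x →ₗ[k] sp X y))
    {x y : Q.V} (a : x ⟶ y) : mp (extRep C X d) a =
      (LinearMap.prod (mp X a ∘ₗ LinearMap.fst k _ _ + d x y a ∘ₗ LinearMap.snd k _ _)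
          (mp C a ∘ₗ LinearMap.snd k _ _) : (sp X x × sp C x) →ₗ[k] (sp X y × sp C y)) := by
  unfold mp extRep
  have := Paths.lift_toPath (C := ModuleCat.{0} k) (V := Q.V)
    { obj := fun v => ModuleCat.of k (sp X v × sp C v)
      map := fun {x y} a => ModuleCat.ofHom
        (LinearMap.prod (mp X a ∘ₗ LinearMap.fst k _ _ + d x y a ∘ₗ LinearMap.snd k _ _)
          (mp C a ∘ₗ LinearMap.snd k _ _)) } a
  exact congrArg ModuleCat.Hom.hom this

/-- inclusion -/
def extI (C X : RepC k Q) (d : ∀ x y : Q.V, (x ⟶ y) → (sp C x →ₗ[k] sp X y)) :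
    X ⟶ extRep C X d :=
  mkHom (fun v => (LinearMap.inl k (sp X v) (sp C v))) (by
    intro x y a m
    rw [mp_extRep]
    have e1 : mp X a m = mp X a m + d x y a 0 := by rw [map_zero, add_zero]
    have e2 : (0 : sp C y) = mp C a 0 := by rw [map_zero]
    exact Prod.ext e1 e2)

/-- projection -/
def extP (C X : RepC k Q) (d : ∀ x y : Q.V, (x ⟶ y) → (sp C x →ₗ[k] sp X y)) :
    extRep C X d ⟶ C :=
  mkHom (fun v => (LinearMap.snd k (sp X v) (sp C v))) (by
    intro x y a m
    rw [mp_extRep]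
    rfl)

theorem extIP (C X : RepC k Q) (d : ∀ x y : Q.V, (x ⟶ y) → (sp C x →ₗ[k] sp X y)) :
    extI C X d ≫ extP C X d = 0 := by
  apply ap_ext
  intro v m
  rw [ap_comp, ap_zero]
  rfl

theorem ext_shortExact (C X : RepC k Q) (d : ∀ x y : Q.V, (x ⟶ y) → (sp C x →ₗ[k] sp X y)) :
    (ShortComplex.mk (extI C X d) (extP C X d) (extIP C X d)).ShortExact := by
  have hm : Mono (extI C X d) := by
    rw [mono_iff]
    intro v a b h
    exact congrArg Prod.fst h
  have he : Epi (extP C X d) := by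
    rw [epi_iff]
    intro v c
    exact ⟨((0 : sp X v), c), rfl⟩
  refine { exact := ?_, mono_f := hm, epi_g := he }
  apply ShortComplex.exact_of_f_is_kernel
  refine KernelFork.IsLimit.ofι' _ _ ?_
  intro A u hu
  have hu' : ∀ v (m : sp A v), (ap u v m : sp X v × sp C v).2 = 0 := by
    intro v m
    have := congrArg (fun t => ap t v m) hu
    simp only [ap_comp, ap_zero] at this
    exact this
  refine ⟨mkHom (fun v => (LinearMap.fst k (sp X v) (sp C v)) ∘ₗ ap u v) ?_, ?_⟩
  · intro x y a m
    have := congrArg (fun t : sp X y × sp C y => t.1) (ap_nat u a m)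
    rw [mp_extRep] at this
    refine this.trans ?_
    have key : ∀ t : sp X x × sp C x, t.2 = 0 → mp X a t.1 + d x y a t.2 = mp X a t.1 := by
      intro t ht
      rw [ht, map_zero, add_zero]
    exact key _ (hu' x m)
  · apply ap_ext
    intro v m
    rw [ap_comp]
    refine Prod.ext ?_ ?_
    · rfl
    · exact (hu' v m).symm

theorem ext0_of_ext1 {C X : RepC k Q} (h : Ext1Zero C X) : Ext0 C X := by
  intro d
  obtain ⟨r, hr⟩ := h _ _ _ _ (ext_shortExact C X d)
  refine ⟨fun v => ap r v ∘ₗ (LinearMap.inr k (sp X v) (sp C v)), fun x y a c => ?_⟩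
  have h1 := ap_nat r a ((0, c) : sp X x × sp C x)
  rw [mp_extRep] at h1
  have h2 : ∀ v (m : sp X v), ap r v ((m, 0) : sp X v × sp C v) = m := by
    intro v m
    have := congrArg (fun t => ap t v m) hr
    simp only [ap_comp, ap_id] at this
    exact this
  rw [eq_sub_iff_add_eq]
  refine Eq.trans ?_ h1
  conv_lhs => rw [← h2 y (d x y a c)]
  refine (map_add (ap r y) _ _).symm.trans ?_
  congr 1
  have e1 : d x y a c + 0 = mp X a 0 + d x y a c := by rw [map_zero, add_zero, zero_add]
  have e2 : 0 + mp C a c = mp C a c := zero_add _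
  exact Prod.ext e1 e2

theorem finDim_of_mono {M N : RepC k Q} (f : M ⟶ N) (hf : Mono f) (h : FinDim N) : FinDim M := by
  intro v
  have := h v
  exact Module.Finite.of_injective (ap f v) ((mono_iff f).1 hf v)

theorem finDim_of_epi {M N : RepC k Q} (f : M ⟶ N) (hf : Epi f) (h : FinDim M) : FinDim N := by
  intro v
  have := h v
  exact Module.Finite.of_surjective (ap f v) ((epi_iff f).1 hf v)

theorem finDim_biproduct {ι : Type} [Fintype ι] {f : ι → RepC k Q} (h : ∀ i, FinDim (f i)) :
    FinDim (⨁ f) := by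
  intro v
  have := fun i => h i v
  refine Module.Finite.of_injective
    (LinearMap.pi (fun i => ap (biproduct.π f i) v) : sp (⨁ f) v →ₗ[k] ∀ i, sp (f i) v) ?_
  rw [injective_iff_map_eq_zero]
  intro m hm
  rw [← ap_total f v m]
  refine Finset.sum_eq_zero fun i _ => ?_
  have : ap (biproduct.π f i) v m = 0 := congrFun hm i
  rw [this, map_zero]

theorem finDim_summand {M N : RepC k Q} (h : IsSummand M N) (hN : FinDim N) : FinDim M := by
  obtain ⟨i, r, e⟩ := h
  exact finDim_of_mono i (mono_of_mono_fac e) hN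

theorem hom_finite {M N : RepC k Q} (hM : FinDim M) (hN : FinDim N) : Module.Finite k (M ⟶ N) := by
  have := fun v => hM v
  have := fun v => hN v
  let F : (M ⟶ N) →ₗ[k] (∀ v : Q.V, sp M v →ₗ[k] sp N v) :=
    { toFun := fun f v => ap f v
      map_add' := fun f g => rfl
      map_smul' := fun c f => rfl }
  refine Module.Finite.of_injective F ?_
  intro f g h
  apply ap_ext
  intro v m
  exact LinearMap.congr_fun (congrFun h v) m

theorem approx {M N : RepC k Q} (hM : FinDim M) (hN : FinDim N) :
    ∃ (n : ℕ) (π : (⨁ (fun _ : Fin n => M)) ⟶ N), ∀ φ : M ⟶ N, ∃ g, g ≫ π = φ := by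
  have := hom_finite hM hN
  obtain ⟨n, s, hs⟩ := Module.Finite.exists_fin (R := k) (M := (M ⟶ N))
  refine ⟨n, biproduct.desc s, fun φ => ?_⟩
  have : φ ∈ Submodule.span k (Set.range s) := by rw [hs]; trivial
  obtain ⟨c, hc⟩ := (Submodule.mem_span_range_iff_exists_fun k).1 this
  refine ⟨biproduct.lift (fun i => c i • 𝟙 M), ?_⟩
  rw [biproduct.lift_desc, ← hc]
  simp

theorem eq_const {C : Type*} {n : ℕ} {f : Fin n → C} {X : C} (h : ∀ i, f i ∈ ({X} : Set C)) :
    f = fun _ => X := funext h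

theorem mem_gen_iff {C X : RepC k Q} (hC : FinDim C) :
    X ∈ gen ({C} : Set (RepC k Q)) ↔
      FinDim X ∧ ∀ (W : RepC k Q) (g : X ⟶ W), (∀ φ : C ⟶ X, φ ≫ g = 0) → g = 0 := by
  constructor
  · rintro ⟨A, ⟨n, f, hf, i, r, e⟩, p, hp⟩
    obtain rfl := eq_const hf
    have hr : Epi r := epi_of_epi_fac e
    have hrp : Epi (r ≫ p) := epi_comp r p
    refine ⟨finDim_of_epi (r ≫ p) hrp (finDim_biproduct fun _ => hC), fun W g hg => ?_⟩
    rw [← cancel_epi (r ≫ p), comp_zero]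
    apply biproduct.hom_ext'
    intro j
    rw [comp_zero, ← Category.assoc]
    exact hg _
  · rintro ⟨hX, h⟩
    obtain ⟨n, π, hπ⟩ := approx hC hX
    refine ⟨_, ⟨n, fun _ => C, fun _ => rfl, 𝟙 _, 𝟙 _, Category.comp_id _⟩, π, ?_⟩
    apply Preadditive.epi_of_cancel_zero
    intro W g hg
    apply h
    intro φ
    obtain ⟨u, rfl⟩ := hπ φ
    rw [Category.assoc, hg, comp_zero]

theorem gen_ext0 {C X : RepC k Q} (h : Ext1Zero C C) (hX : X ∈ gen ({C} : Set (RepC k Q))) :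
    Ext0 C X := by
  obtain ⟨A, ⟨n, f, hf, i, r, e⟩, p, hp⟩ := hX
  obtain rfl := eq_const hf
  have hr : Epi r := epi_of_epi_fac e
  exact ((Ext0.biprod_right fun _ => ext0_of_ext1 h).of_epi r hr).of_epi p hp

theorem gen_torsion {C : RepC k Q} (hC : FinDim C) (h : Ext1Zero C C) :
    IsTorsionClass (gen ({C} : Set (RepC k Q))) := by
  have hq : ∀ X ∈ gen ({C} : Set (RepC k Q)), ∀ (Y : RepC k Q) (p : X ⟶ Y), Epi p →
      Y ∈ gen ({C} : Set (RepC k Q)) := by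
    rintro X ⟨A, hA, q, hq⟩ Y p hp
    exact ⟨A, hA, q ≫ p, epi_comp q p⟩
  have hext : ∀ S : ShortComplex (RepC k Q), S.ShortExact → S.X₁ ∈ gen ({C} : Set (RepC k Q)) →
      S.X₃ ∈ gen ({C} : Set (RepC k Q)) → S.X₂ ∈ gen ({C} : Set (RepC k Q)) := by
    intro S hS h1 h3
    have e1 := gen_ext0 h h1
    rw [mem_gen_iff hC] at h1 h3 ⊢
    refine ⟨?_, fun W g hg => ?_⟩
    · intro v
      have := h1.1 v
      have := h3.1 v
      refine Module.Finite.of_exact (f := ap S.f v) (g := ap S.g v) ?_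
        ((epi_iff S.g).1 hS.epi_g v)
      intro m
      refine ⟨exact_pt hS v m, ?_⟩
      rintro ⟨n, rfl⟩
      rw [← ap_comp, S.zero, ap_zero]
    · have hfg : S.f ≫ g = 0 := h1.2 W _ (fun φ => by rw [← Category.assoc]; exact hg _)
      have := hS.epi_g
      let g' := hS.exact.desc g hfg
      have hg' : S.g ≫ g' = g := hS.exact.g_desc g hfg
      have : g' = 0 := by
        apply h3.2
        intro φ
        obtain ⟨ψ, rfl⟩ := Ext0.lift hS e1 φ
        rw [Category.assoc, hg', hg]
      rw [← hg', this, comp_zero]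
  refine ⟨?_, ?_, ?_, hq, hext⟩
  · rw [mem_gen_iff hC]
    refine ⟨fun v => ?_, fun W g _ => (isZero_zero _).eq_of_src _ _⟩
    have : ∀ m : sp (0 : RepC k Q) v, m = 0 := by
      intro m
      have e : 𝟙 (0 : RepC k Q) = 0 := (isZero_zero _).eq_of_src _ _
      rw [← ap_id _ v m, e, ap_zero]
    have : Subsingleton (sp (0 : RepC k Q) v) := ⟨fun a b => by rw [this a, this b]⟩
    infer_instance
  · intro X hX Y hY
    exact hext (ShortComplex.mk (biprod.inl : X ⟶ X ⊞ Y) biprod.snd (by simp))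
      (ShortComplex.Splitting.ofHasBinaryBiproduct X Y).shortExact hX hY
  · rintro X hX Y ⟨i, r, e⟩
    exact hq X hX Y r (epi_of_epi_fac e)
theorem indec_summand {P X : RepC k Q} (hP : Indec P) (i : X ⟶ P) (r : P ⟶ X) (e : i ≫ r = 𝟙 X) :
    IsZero X ∨ IsIso i := by
  have hs : IsSplitMono i := ⟨⟨⟨r, e⟩⟩⟩
  let b := isBilimitBinaryBiconeOfIsSplitMonoOfCokernel (cokernelIsCokernel i)
  have iso : P ≅ X ⊞ cokernel i := biprod.uniqueUpToIso _ _ b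
  rcases hP.2 _ _ iso with h | h
  · exact Or.inl h
  · right
    have : Epi i := Preadditive.epi_of_isZero_cokernel i h
    exact isIso_of_epi_of_isSplitMono i

theorem indec_idem {P : RepC k Q} (hP : Indec P) (e : End P) (he : e * e = e) : e = 0 ∨ e = 1 := by
  obtain ⟨Y, i, r, h1, h2⟩ := IsIdempotentComplete.idempotents_split P e he
  rcases indec_summand hP i r h1 with h | h
  · left
    rw [← h2, h.eq_of_src i 0, comp_zero]
  · right
    have : r ≫ i = 𝟙 P := by
      rw [← cancel_epi i, ← Category.assoc, h1, Category.id_comp, Category.comp_id]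
    exact h2.symm.trans this

theorem pow_fitting {A : Type} [Ring A] [Algebra k A] [Module.Finite k A] (f : A)
    (hA : ∀ e : A, e * e = e → e = 0 ∨ e = 1) : IsNilpotent f ∨ IsUnit f := by
  let R := Algebra.adjoin k {f}
  have : IsMulCommutative R := Algebra.isMulCommutative_adjoin k (by
    intro a ha b hb
    rw [Set.mem_singleton_iff.1 ha, Set.mem_singleton_iff.1 hb])
  have : IsArtinianRing R := IsArtinianRing.of_finite k R
  let x : R := ⟨f, Algebra.self_mem_adjoin_singleton k f⟩
  obtain ⟨n, y, hy⟩ := IsArtinian.exists_pow_succ_smul_dvd x (1 : R)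
  simp only [smul_eq_mul, mul_one] at hy
  have hxy : x ^ n * (x * y) = x ^ n := by rw [← mul_assoc, ← pow_succ, hy]
  have hm : ∀ m : ℕ, x ^ n * (x * y) ^ m = x ^ n := by
    intro m
    induction m with
    | zero => simp
    | succ m ih => rw [pow_succ, ← mul_assoc, ih, hxy]
  have hidem : (x * y) ^ n * (x * y) ^ n = (x * y) ^ n := by
    conv_lhs => rw [mul_pow x y n]
    rw [mul_right_comm, ← mul_pow, hm n, mul_pow]
  have hxf : ((x : R) : A) = f := rfl
  rcases hA (((x * y) ^ n : R) : A) (by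
    exact_mod_cast congrArg (fun t : R => (t : A)) hidem) with h | h
  · left
    refine ⟨n, ?_⟩
    have h0 : (x * y) ^ n = 0 := Subtype.ext h
    have := hm n
    rw [h0, mul_zero] at this
    have := congrArg (fun t : R => (t : A)) this
    simpa using this.symm
  · right
    have h0 : (x * y) ^ n = 1 := Subtype.ext h
    have hu : IsUnit x := by
      rcases Nat.eq_zero_or_pos n with rfl | hn
      · rw [pow_zero, one_mul] at hxy
        exact IsUnit.of_mul_eq_one _ hxy
      · have : IsUnit (x * y) := IsUnit.of_pow_eq_one h0 hn.ne'
        exact isUnit_of_mul_isUnit_left this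
    exact hu.map (Algebra.adjoin k {f}).val

theorem sum_unit {A : Type} [Ring A] (hA : ∀ f : A, IsNilpotent f ∨ IsUnit f) {ι : Type}
    [Nontrivial A] (s : Finset ι) : ∀ (f : ι → A), IsUnit (∑ i ∈ s, f i) → ∃ i ∈ s, IsUnit (f i) := by
  classical
  induction s using Finset.induction_on with
  | empty => intro f h; simp at h
  | insert j s hj ih =>
    intro f h
    rw [Finset.sum_insert hj] at h
    obtain ⟨u, hu⟩ := h
    have h1 : ↑u⁻¹ * f j + ↑u⁻¹ * ∑ i ∈ s, f i = 1 := by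
      rw [← mul_add, ← hu, Units.inv_mul]
    rcases hA (↑u⁻¹ * f j) with hn | hn
    · have : IsUnit (↑u⁻¹ * ∑ i ∈ s, f i) := by
        rw [← eq_sub_iff_add_eq'] at h1
        rw [h1]
        exact hn.isUnit_one_sub
      have h2 := u.isUnit.mul this
      rw [Units.mul_inv_cancel_left] at h2
      obtain ⟨i, hi, h⟩ := ih f h2
      exact ⟨i, Finset.mem_insert_of_mem hi, h⟩
    · have h2 := u.isUnit.mul hn
      rw [Units.mul_inv_cancel_left] at h2
      exact ⟨j, Finset.mem_insert_self _ _, h2⟩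

theorem indec_summand_biproduct {P : RepC k Q} (hP : Indec P) (hfd : FinDim P) {n : ℕ}
    {f : Fin n → RepC k Q} (h : IsSummand P (⨁ f)) : ∃ i, IsSummand P (f i) := by
  obtain ⟨i, r, e⟩ := h
  have : Module.Finite k (End P) := hom_finite hfd hfd
  have hnt : Nontrivial (End P) := by
    refine ⟨0, 1, fun h => hP.1 ?_⟩
    rw [IsZero.iff_id_eq_zero]
    exact h.symm
  have hsum : ∑ j, ((i ≫ biproduct.π f j) ≫ biproduct.ι f j ≫ r) = 𝟙 P := by
    have : i ≫ (∑ j, biproduct.π f j ≫ biproduct.ι f j) ≫ r = 𝟙 P := by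
      rw [biproduct.total, Category.id_comp, e]
    rw [Preadditive.sum_comp, Preadditive.comp_sum] at this
    simp only [Category.assoc] at this ⊢
    exact this
  obtain ⟨j, -, hj⟩ := sum_unit (A := End P) (fun g => pow_fitting (k := k) g (indec_idem hP)) Finset.univ
    (fun j => ((i ≫ biproduct.π f j) ≫ biproduct.ι f j ≫ r : End P)) (by
      exact hsum.symm ▸ (isUnit_one : IsUnit (1 : End P)))
  have hiso : IsIso ((i ≫ biproduct.π f j) ≫ biproduct.ι f j ≫ r) := (isUnit_iff_isIso _).1 hj
  refine ⟨j, i ≫ biproduct.π f j,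
    (biproduct.ι f j ≫ r) ≫ inv ((i ≫ biproduct.π f j) ≫ biproduct.ι f j ≫ r), ?_⟩
  rw [← Category.assoc, IsIso.hom_inv_id]

theorem indec_of_add {P C : RepC k Q} (hP : Indec P) (hC : FinDim C)
    (h : P ∈ addSet ({C} : Set (RepC k Q))) : IsSummand P C := by
  obtain ⟨n, f, hf, hs⟩ := h
  obtain rfl := eq_const hf
  obtain ⟨i, hi⟩ := indec_summand_biproduct hP
    (finDim_summand hs (finDim_biproduct fun _ => hC)) hs
  exact hi

theorem simple_subquot {S : RepC k Q} (hS : Simple S) {ι : Type} (M : ι → RepC k Q)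
    (s : Finset ι) : ∀ (N : RepC k Q) (p : N ⟶ S) (_ : Epi p) (u : ∀ i, N ⟶ M i),
      (∀ (W : RepC k Q) (g : W ⟶ N), (∀ i ∈ s, g ≫ u i = 0) → g = 0) →
      ∃ i, IsSubquotient S (M i) := by
  classical
  induction s using Finset.induction_on with
  | empty =>
    intro N p hp u h
    exfalso
    have h1 := h N (𝟙 N) (by simp)
    have h2 : p = 0 := by rw [← Category.id_comp p, h1, zero_comp]
    apply Simple.not_isZero S
    rw [IsZero.iff_id_eq_zero, ← cancel_epi p, h2, zero_comp, zero_comp]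
  | insert j s hj ih =>
    intro N p hp u h
    by_cases hk : kernel.ι (u j) ≫ p = 0
    · refine ⟨j, Abelian.coimage (u j), Abelian.factorThruCoimage (u j),
        cokernel.desc _ p hk, inferInstance, ?_⟩
      have : Epi (cokernel.π (kernel.ι (u j)) ≫ cokernel.desc _ p hk) := by
        rw [cokernel.π_desc]; exact hp
      exact epi_of_epi (cokernel.π (kernel.ι (u j))) _
    · refine ih (kernel (u j)) (kernel.ι (u j) ≫ p) (epi_of_nonzero_to_simple hk)
        (fun i => kernel.ι (u j) ≫ u i) ?_
      intro W g hg
      rw [← cancel_mono (kernel.ι (u j)), zero_comp]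
      apply h
      intro i hi
      rw [Category.assoc]
      rcases Finset.mem_insert.1 hi with rfl | hi
      · rw [kernel.condition, comp_zero]
      · exact hg i hi

theorem suppLE_sub {M N C : RepC k Q} (i : N ⟶ M) (hi : Mono i) (h : SuppLE M C) : SuppLE N C := by
  rintro S hS ⟨L, j, p, hj, hp⟩
  exact h S hS ⟨L, j ≫ i, p, mono_comp j i, hp⟩

theorem suppLE_sum {C : RepC k Q} (n : ℕ) : SuppLE (⨁ (fun _ : Fin n => C)) C := by
  rintro S hS ⟨L, j, p, hj, hp⟩
  obtain ⟨_, h⟩ := simple_subquot hS (fun _ : Fin n => C) Finset.univ L p hp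
    (fun i => j ≫ biproduct.π _ i) (by
      intro W g hg
      rw [← cancel_mono j, zero_comp]
      apply biproduct.hom_ext
      intro i
      rw [zero_comp, Category.assoc]
      exact hg i (Finset.mem_univ _))
  exact h
theorem path_finite (x : Q.V) (y : Q.V) : Finite (Quiver.Path x y) := by
  let r : Q.V → Q.V → Prop := fun a b => ∃ p : Quiver.Path a b, 0 < p.length
  have htr : IsTrans Q.V r := ⟨by
    rintro a b c ⟨p, hp⟩ ⟨q, hq⟩
    exact ⟨p.comp q, by rw [Quiver.Path.length_comp]; omega⟩⟩
  have hir : Std.Irrefl r := ⟨by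
    rintro a ⟨p, hp⟩
    rw [Q.acyclic a p] at hp
    simp at hp⟩
  have hwf : WellFounded r := Finite.wellFounded_of_trans_of_irrefl r
  induction y using hwf.induction with
  | _ y ih =>
    have h1 : ∀ z : Q.V, Finite (Quiver.Path x z × (z ⟶ y)) := by
      intro z
      rcases isEmpty_or_nonempty (z ⟶ y) with h | ⟨⟨a⟩⟩
      · infer_instance
      · have := ih z ⟨a.toPath, by simp⟩
        infer_instance
    let F : Option (Σ z : Q.V, Quiver.Path x z × (z ⟶ y)) → Option (Quiver.Path x y) := fun t =>
      t.map fun t => t.2.1.cons t.2.2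
    have hF : ∀ p : Quiver.Path x y, p.length = 0 ∨ ∃ t : (Σ z : Q.V, Quiver.Path x z × (z ⟶ y)),
        t.2.1.cons t.2.2 = p := by
      intro p
      cases p with
      | nil => exact Or.inl rfl
      | cons p a => exact Or.inr ⟨⟨_, p, a⟩, rfl⟩
    have hfin : (Set.range fun t : (Σ z : Q.V, Quiver.Path x z × (z ⟶ y)) =>
      t.2.1.cons t.2.2).Finite := Set.finite_range _
    have h0 : {p : Quiver.Path x y | p.length = 0}.Finite := by
      apply Set.Subsingleton.finite
      intro p hp q hq
      have hxy := Quiver.Path.eq_of_length_zero p hp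
      subst hxy
      rw [Q.acyclic _ p, Q.acyclic _ q]
    refine Set.finite_univ_iff.1 ((h0.union hfin).subset ?_)
    intro p _
    exact hF p

/-- the projective representation at a vertex -/
def Pr (k : Type) [Field k] (x : Q.V) : RepC k Q :=
  Paths.lift
    { obj := fun v => ModuleCat.of k (Quiver.Path x v →₀ k)
      map := fun {_ _} a => ModuleCat.ofHom
        (Finsupp.lmapDomain k k (fun p : Quiver.Path x _ => p.cons a)) }

theorem mp_Pr (x : Q.V) {v w : Q.V} (a : v ⟶ w) :
    mp (Pr k x) a = Finsupp.lmapDomain k k (fun p : Quiver.Path x v => p.cons a) := by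
  unfold mp Pr
  have := Paths.lift_toPath (C := ModuleCat.{0} k) (V := Q.V)
    { obj := fun v => ModuleCat.of k (Quiver.Path x v →₀ k)
      map := fun {_ _} a => ModuleCat.ofHom
        (Finsupp.lmapDomain k k (fun p : Quiver.Path x _ => p.cons a)) } a
  exact congrArg ModuleCat.Hom.hom this

/-- evaluate a path at an element -/
def ev (M : RepC k Q) {x : Q.V} (m : sp M x) : ∀ {v : Q.V}, Quiver.Path x v → sp M v
  | _, .nil => m
  | _, .cons p a => mp M a (ev M m p)

/-- basis element of `Pr` -/
def bs (k : Type) [Field k] {x v : Q.V} (p : Quiver.Path x v) : sp (Pr k x) v :=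
  (Finsupp.single p 1 : Quiver.Path x v →₀ k)

theorem mp_bs {x v w : Q.V} (p : Quiver.Path x v) (a : v ⟶ w) :
    mp (Pr k x) a (bs k p) = bs k (p.cons a) := by
  rw [mp_Pr]
  exact Finsupp.mapDomain_single

theorem lin_ext {x v : Q.V} {N : Type} [AddCommGroup N] [Module k N]
    (f g : sp (Pr k x) v →ₗ[k] N) (h : ∀ p : Quiver.Path x v, f (bs k p) = g (bs k p)) : f = g := by
  have : ∀ f g : (Quiver.Path x v →₀ k) →ₗ[k] N,
      (∀ p : Quiver.Path x v, f (Finsupp.single p 1) = g (Finsupp.single p 1)) → f = g := by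
    intro f g h
    apply Finsupp.lhom_ext'
    intro p
    apply LinearMap.ext_ring
    exact h p
  exact this f g h

theorem ap_bs {x : Q.V} {M : RepC k Q} (f : Pr k x ⟶ M) {v : Q.V} (p : Quiver.Path x v) :
    ap f v (bs k p) = ev M (ap f x (bs k Quiver.Path.nil)) p := by
  induction p with
  | nil => rfl
  | cons p a ih => rw [← mp_bs, ap_nat, ih]; rfl

/-- linear part -/
def prLin {x : Q.V} (M : RepC k Q) (m : sp M x) (v : Q.V) : sp (Pr k x) v →ₗ[k] sp M v :=
  (Finsupp.linearCombination k (fun p : Quiver.Path x v => ev M m p) :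
    (Quiver.Path x v →₀ k) →ₗ[k] sp M v)

theorem prLin_bs {x : Q.V} (M : RepC k Q) (m : sp M x) {v : Q.V} (p : Quiver.Path x v) :
    prLin M m v (bs k p) = ev M m p := by
  have h1 : (Finsupp.linearCombination k (fun p : Quiver.Path x v => ev M m p))
      (Finsupp.single p 1) = ev M m p := by
    rw [Finsupp.linearCombination_single, one_smul]
  exact h1

/-- the morphism from `Pr` given by an element -/
def prDesc {x : Q.V} (M : RepC k Q) (m : sp M x) : Pr k x ⟶ M :=
  mkHom (fun v => prLin M m v) (by
    intro v w a n
    refine LinearMap.congr_fun (lin_ext (N := sp M w)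
      (prLin M m w ∘ₗ mp (Pr k x) a) (mp M a ∘ₗ prLin M m v) ?_) n
    intro p
    have e1 : prLin M m w (mp (Pr k x) a (bs k p)) = mp M a (prLin M m v (bs k p)) := by
      rw [mp_bs, prLin_bs, prLin_bs]; rfl
    exact e1)

theorem prDesc_nil {x : Q.V} (M : RepC k Q) (m : sp M x) :
    ap (prDesc M m) x (bs k Quiver.Path.nil) = m := by
  have h1 : (Finsupp.linearCombination k (fun p : Quiver.Path x x => ev M m p))
      (Finsupp.single Quiver.Path.nil 1) = m := by
    rw [Finsupp.linearCombination_single, one_smul]; rfl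
  exact h1

theorem pr_ext {x : Q.V} {M : RepC k Q} (f g : Pr k x ⟶ M)
    (h : ap f x (bs k Quiver.Path.nil) = ap g x (bs k Quiver.Path.nil)) : f = g := by
  apply ap_ext
  intro v m
  refine LinearMap.congr_fun (lin_ext (N := sp M v) (ap f v) (ap g v) ?_) m
  intro p
  exact (ap_bs f p).trans ((congrArg (fun t => ev M t p) h).trans (ap_bs g p).symm)

theorem pr_projective (x : Q.V) : Projective (Pr k x) := by
  constructor
  intro E X f e he
  obtain ⟨m, hm⟩ := (epi_iff e).1 he x (ap f x (bs k Quiver.Path.nil))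
  refine ⟨prDesc E m, pr_ext _ _ ?_⟩
  rw [ap_comp, prDesc_nil, hm]

theorem pr_finDim (x : Q.V) : FinDim (Pr k x) := by
  intro v
  have := path_finite x v
  have : Module.Finite k (Quiver.Path x v →₀ k) := inferInstance
  exact this

theorem enough_proj {X : RepC k Q} (hX : FinDim X) :
    ∃ (R : RepC k Q) (π : R ⟶ X), Projective R ∧ FinDim R ∧ Epi π := by
  have := fun v => hX v
  let ι := Σ v : Q.V, Fin (Module.finrank k (sp X v))
  let f : ι → RepC k Q := fun i => Pr k i.1
  have hpr : ∀ i, Projective (f i) := fun i => pr_projective _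
  refine ⟨⨁ f, biproduct.desc fun i => prDesc X (Module.finBasis k (sp X i.1) i.2), inferInstance,
    finDim_biproduct fun i => pr_finDim _, ?_⟩
  rw [epi_iff]
  intro v
  rw [← LinearMap.range_eq_top, eq_top_iff, ← (Module.finBasis k (sp X v)).span_eq,
    Submodule.span_le]
  rintro _ ⟨j, rfl⟩
  refine ⟨ap (biproduct.ι f ⟨v, j⟩) v (bs k Quiver.Path.nil), ?_⟩
  rw [← ap_comp, biproduct.ι_desc, prDesc_nil]

/-- total dimension -/
def tdim (M : RepC k Q) : ℕ := ∑ v, Module.finrank k (sp M v)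

theorem tdim_le {M N : RepC k Q} (p : M ⟶ N) (hp : Epi p) (hM : FinDim M) : tdim N ≤ tdim M := by
  refine Finset.sum_le_sum fun v _ => ?_
  have := hM v
  exact LinearMap.finrank_le_finrank_of_surjective ((epi_iff p).1 hp v)

theorem iso_of_tdim {M N : RepC k Q} (p : M ⟶ N) (hp : Epi p) (hM : FinDim M)
    (h : tdim M ≤ tdim N) : IsIso p := by
  have hN := finDim_of_epi p hp hM
  have hle : ∀ v ∈ Finset.univ, Module.finrank k (sp N v) ≤ Module.finrank k (sp M v) := by
    intro v _
    have := hM v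
    exact LinearMap.finrank_le_finrank_of_surjective ((epi_iff p).1 hp v)
  have heq := (Finset.sum_eq_sum_iff_of_le hle).1 (le_antisymm (Finset.sum_le_sum hle) h)
  have hm : Mono p := by
    rw [mono_iff]
    intro v
    have := hM v
    have := hN v
    exact (LinearMap.injective_iff_surjective_of_finrank_eq_finrank
      (heq v (Finset.mem_univ _)).symm).2 ((epi_iff p).1 hp v)
  exact isIso_of_mono_of_epi p

theorem enough_split_proj {C X : RepC k Q} (hX : FinDim X) (hs : SuppLE X C) :
    ∃ (R : RepC k Q) (π : R ⟶ X), Epi π ∧ SplitProjIn { M : RepC k Q | FinDim M ∧ SuppLE M C } R := by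
  classical
  obtain ⟨R, π, hR, hRf, hπ⟩ := enough_proj hX
  let D : ℕ → Prop := fun n => ∃ (Z : RepC k Q) (q : R ⟶ Z) (t : Z ⟶ X), Epi q ∧ q ≫ t = π ∧
    SuppLE Z C ∧ tdim Z = n
  have hD : D (tdim X) := ⟨X, π, 𝟙 X, hπ, Category.comp_id _, hs, rfl⟩
  have hb : ∀ n, D n → n ≤ tdim R := by
    rintro n ⟨Z, q, t, hq, -, -, rfl⟩
    exact tdim_le q hq hRf
  obtain ⟨Z, q, t, hq, hqt, hZ, hZd⟩ := Nat.findGreatest_spec (hb _ hD) hD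
  refine ⟨Z, t, epi_of_epi_fac hqt, ⟨finDim_of_epi q hq hRf, hZ⟩, ?_⟩
  rintro Y ⟨hYf, hYs⟩ p hp
  let l := Projective.factorThru q p
  have hl : l ≫ p = q := Projective.factorThru_comp q p
  let I := Abelian.image l
  let j : I ⟶ Y := Abelian.image.ι l
  let c : R ⟶ I := Abelian.factorThruImage l
  have hcj : c ≫ j = l := Abelian.image.fac l
  have hfac : c ≫ (j ≫ p) = q := by rw [← Category.assoc, hcj, hl]
  have hepi : Epi (j ≫ p) := epi_of_epi_fac hfac
  have hI : SuppLE I C := suppLE_sub j inferInstance hYs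
  have hIf : FinDim I := finDim_of_mono j inferInstance hYf
  have hDI : D (tdim I) := ⟨I, c, (j ≫ p) ≫ t, inferInstance, by
    rw [← Category.assoc, hfac, hqt], hI, rfl⟩
  have hle : tdim I ≤ tdim Z := by
    rw [hZd]
    exact Nat.le_findGreatest (hb _ hDI) hDI
  have := iso_of_tdim (j ≫ p) hepi hIf hle
  exact ⟨inv (j ≫ p) ≫ j, by rw [Category.assoc, IsIso.inv_hom_id]⟩

theorem mem_gen_of_ext0 {C K : RepC k Q} (hst : IsSupportTilting C)
    (hK : FinDim K) (hs : SuppLE K C) (h : Ext0 C K) : K ∈ gen ({C} : Set (RepC k Q)) := by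
  obtain ⟨R, π, hπ, hR⟩ := enough_split_proj hK hs
  obtain ⟨T', T'', hT', ⟨n, f, hf, u, r, e⟩, i, p, w, hS⟩ := hst.2.2.2 R hR
  obtain rfl := eq_const hf
  have h2 : Ext0 T'' K := (Ext0.biprod_left fun _ => h).of_mono u (mono_of_mono_fac e)
  obtain ⟨g, hg⟩ := Ext0.extend hS h2 π
  exact ⟨T', hT', g, epi_of_epi_fac hg⟩

theorem extProj_of_add {C P : RepC k Q} (h : Ext1Zero C C)
    (hP : P ∈ addSet ({C} : Set (RepC k Q))) : ExtProjIn (gen ({C} : Set (RepC k Q))) P := by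
  refine ⟨⟨P, hP, 𝟙 P, inferInstance⟩, fun X hX => ?_⟩
  obtain ⟨n, f, hf, u, r, e⟩ := hP
  obtain rfl := eq_const hf
  exact ext1_of_ext0 ((Ext0.biprod_left fun _ => gen_ext0 h hX).of_mono u (mono_of_mono_fac e))

theorem add_of_extProj {C P : RepC k Q} (hC : FinDim C) (hst : IsSupportTilting C)
    (hP : ExtProjIn (gen ({C} : Set (RepC k Q))) P) : P ∈ addSet ({C} : Set (RepC k Q)) := by
  obtain ⟨hPg, hPe⟩ := hP
  obtain ⟨hPf, hPc⟩ := (mem_gen_iff hC).1 hPg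
  obtain ⟨n, π, hπ⟩ := approx hC hPf
  have hepi : Epi π := by
    apply Preadditive.epi_of_cancel_zero
    intro W g hg
    apply hPc
    intro φ
    obtain ⟨u, rfl⟩ := hπ φ
    rw [Category.assoc, hg, comp_zero]
  have hS : (ShortComplex.mk (kernel.ι π) π (kernel.condition π)).ShortExact :=
    { exact := ShortComplex.exact_of_f_is_kernel _ (kernelIsKernel π)
      mono_f := inferInstanceAs (Mono (kernel.ι π))
      epi_g := hepi }
  have hinj := (mono_iff (kernel.ι π)).1 inferInstance
  have hE : Ext0 C (kernel π) := by
    intro d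
    obtain ⟨h, hh⟩ := Ext0.biprod_right (f := fun _ : Fin n => C)
      (fun _ => ext0_of_ext1 hst.1) (fun x y a => ap (kernel.ι π) y ∘ₗ d x y a)
    have hz : ∀ v m, ap π v (ap (kernel.ι π) v m) = 0 := fun v m => by
      rw [← ap_comp, kernel.condition, ap_zero]
    obtain ⟨g, hg⟩ := hπ (mkHom (fun v => ap π v ∘ₗ h v) (by
      intro x y a m
      have := congrArg (ap π y) (hh x y a m)
      simp only [LinearMap.comp_apply, map_sub, hz, ap_nat] at this ⊢
      exact (sub_eq_zero.1 this.symm).symm))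
    have hg' : ∀ v m, ap π v (ap g v m) = ap π v (h v m) := by
      intro v m
      rw [← ap_comp, hg]; rfl
    choose t ht using fun v => LinearMap.exists_leftInverse_of_injective (ap (kernel.ι π) v)
      (LinearMap.ker_eq_bot.2 (hinj v))
    have ht' : ∀ v m, ap π v m = 0 → ap (kernel.ι π) v (t v m) = m := by
      intro v m hm
      obtain ⟨c, rfl⟩ := exact_pt hS v m hm
      exact congrArg (ap (kernel.ι π) v) (LinearMap.congr_fun (ht v) c)
    have key : ∀ v m, ap (kernel.ι π) v (t v (h v m - ap g v m)) = h v m - ap g v m := by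
      intro v m
      apply ht'
      rw [map_sub, hg', sub_self]
    refine ⟨fun v => t v ∘ₗ (h v - ap g v), fun x y a c => ?_⟩
    apply hinj y
    refine (hh x y a c).trans ?_
    simp only [LinearMap.comp_apply, LinearMap.sub_apply]
    rw [map_sub, ap_nat, key, key, map_sub, ap_nat]
    abel
  have hK : kernel π ∈ gen ({C} : Set (RepC k Q)) :=
    mem_gen_of_ext0 hst (finDim_of_mono (kernel.ι π) inferInstance (finDim_biproduct fun _ => hC))
      (suppLE_sub (kernel.ι π) inferInstance (suppLE_sum n)) hE
  obtain ⟨s, hs⟩ := Ext0.lift hS (ext0_of_ext1 (hPe _ hK)) (𝟙 P)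
  exact ⟨n, fun _ => C, fun _ => rfl, s, π, hs⟩

theorem isSummand_trans {X Y Z : RepC k Q} (h : IsSummand X Y) (h' : IsSummand Y Z) :
    IsSummand X Z := by
  obtain ⟨i, r, e⟩ := h
  obtain ⟨j, s, e'⟩ := h'
  refine ⟨i ≫ j, s ≫ r, ?_⟩
  rw [Category.assoc, ← Category.assoc j, e', Category.id_comp, e]

theorem add_of_isSummand {X C : RepC k Q} (h : IsSummand X C) :
    X ∈ addSet ({C} : Set (RepC k Q)) := by
  refine ⟨1, fun _ => C, fun _ => rfl, isSummand_trans h ⟨biproduct.ι (fun _ : Fin 1 => C) 0,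
    biproduct.π (fun _ : Fin 1 => C) 0, ?_⟩⟩
  rw [biproduct.ι_π_self]

theorem main_aux (C0 : RepC k Q) (hfd : FinDim C0) (hst : IsSupportTilting C0) :
    IsTorsionClass (gen ({C0} : Set (RepC k Q))) ∧
    (∀ P : RepC k Q, Indec P →
      (ExtProjIn (gen ({C0} : Set (RepC k Q))) P ↔ IsSummand P C0)) ∧
    (∀ B : RepC k Q, IsBasic B → addSet ({B} : Set (RepC k Q)) = addSet {C0} →
      IsExtProjSum (gen ({C0} : Set (RepC k Q))) B) := by
  refine ⟨gen_torsion hfd hst.1, fun P hP => ⟨fun h => ?_, fun h => ?_⟩, ?_⟩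
  · exact indec_of_add hP hfd (add_of_extProj hfd hst h)
  · exact extProj_of_add hst.1 (add_of_isSummand h)
  · rintro B ⟨n, f, hf, hinj, ⟨φ⟩⟩ hB
    have hBf : FinDim B := by
      have : B ∈ addSet ({C0} : Set (RepC k Q)) := by
        rw [← hB]; exact add_of_isSummand ⟨𝟙 B, 𝟙 B, Category.comp_id _⟩
      obtain ⟨m, g, hg, hs⟩ := this
      obtain rfl := eq_const hg
      exact finDim_summand hs (finDim_biproduct fun _ => hfd)
    refine ⟨n, f, fun i => ⟨hf i, ?_⟩, hinj, ?_, ⟨φ⟩⟩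
    · apply extProj_of_add hst.1
      rw [← hB]
      apply add_of_isSummand
      refine ⟨biproduct.ι f i ≫ φ.inv, φ.hom ≫ biproduct.π f i, ?_⟩
      rw [Category.assoc, φ.inv_hom_id_assoc, biproduct.ι_π_self]
    · intro P hP hPe
      have h1 := add_of_extProj hfd hst hPe
      rw [← hB] at h1
      have h2 := indec_of_add hP hBf h1
      have h3 : IsSummand P (⨁ f) := isSummand_trans h2 ⟨φ.hom, φ.inv, φ.hom_inv_id⟩
      obtain ⟨i, u, r, e⟩ := indec_summand_biproduct hP (finDim_summand h2 hBf) h3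
      refine ⟨i, ?_⟩
      rcases indec_summand (hf i) u r e with h | h
      · exact absurd h hP.1
      · exact ⟨asIso u⟩

end Helpers

section Statement2

/-- If `C0` is a support tilting object of `rep Q` then `Gen C0` is a
torsion class, the indecomposable Ext-projectives of `Gen C0` are exactly the
indecomposable direct summands of `C0`, and in particular the basic module `bsc C0`
(a basic module with the same additive closure as `C0`) is the direct sum of the
indecomposable Ext-projectives of `Gen C0`. -/
theorem statement2 (k : Type) [Field k] [IsAlgClosed k] (Q : FinQuiver)
    (C0 : RepC k Q) (hfd : FinDim C0) (hst : IsSupportTilting C0) :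
    IsTorsionClass (gen ({C0} : Set (RepC k Q))) ∧
    (∀ P : RepC k Q, Indec P →
      (ExtProjIn (gen ({C0} : Set (RepC k Q))) P ↔ IsSummand P C0)) ∧
    (∀ B : RepC k Q, IsBasic B → addSet ({B} : Set (RepC k Q)) = addSet {C0} →
      IsExtProjSum (gen ({C0} : Set (RepC k Q))) B) := by
  exact main_aux C0 hfd hst

end Statement2
end NCPaper
end
end

section
/- For a finite acyclic quiver Q, the assignment sending a finitely generated torsion class T to the direct sum of one representative of each isomorphism class of indecomposable Ext-projective objects of T, and the assignment C ↦ Gen C, are mutually inverse bijections between finitely generated torsion classes in rep Q and isomorphism classes of basic support tilting modules. -/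
open CategoryTheory CategoryTheory.Limits ZeroObject

attribute [local instance] CategoryTheory.Abelian.hasFiniteBiproducts

noncomputable section

namespace NCPaper

variable (k : Type) [Field k] (Q : FinQuiver)

variable {k Q}

section Statement3


set_option linter.unusedSectionVars false

section AbCat
variable {C : Type*} [Category C] [Abelian C]

lemma ses_of_epi {X Y : C} (p : X ⟶ Y) [Epi p] :
    (ShortComplex.mk (kernel.ι p) p (kernel.condition p)).ShortExact where
  exact := ShortComplex.exact_kernel p

lemma ses_of_mono {X Y : C} (i : X ⟶ Y) [Mono i] :
    (ShortComplex.mk i (cokernel.π i) (cokernel.condition i)).ShortExact where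
  exact := ShortComplex.exact_cokernel i

lemma ses_desc {K E A : C} {i : K ⟶ E} {p : E ⟶ A} {w : i ≫ p = 0}
    (hS : (ShortComplex.mk i p w).ShortExact) {Z : C} (f : E ⟶ Z) (hf : i ≫ f = 0) :
    ∃ g : A ⟶ Z, p ≫ g = f := by
  have : Epi p := hS.epi_g
  obtain ⟨l, hl⟩ := CokernelCofork.IsColimit.desc' hS.gIsCokernel f hf
  exact ⟨l, hl⟩

lemma ses_lift {K E A : C} {i : K ⟶ E} {p : E ⟶ A} {w : i ≫ p = 0}
    (hS : (ShortComplex.mk i p w).ShortExact) {Z : C} (f : Z ⟶ E) (hf : f ≫ p = 0) :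
    ∃ g : Z ⟶ K, g ≫ i = f := by
  have : Mono i := hS.mono_f
  obtain ⟨l, hl⟩ := KernelFork.IsLimit.lift' hS.fIsKernel f hf
  exact ⟨l, hl⟩

lemma ext_ext {A X : C} (h : Ext1Zero A X) {K E : C} (i : K ⟶ E) (p : E ⟶ A) (w : i ≫ p = 0)
    (hS : (ShortComplex.mk i p w).ShortExact) (g : K ⟶ X) : ∃ e : E ⟶ X, i ≫ e = g := by
  have : Mono i := hS.mono_f
  have : Epi p := hS.epi_g
  obtain ⟨d, hd', hd⟩ : ∃ d : pushout i g ⟶ A, pushout.inl i g ≫ d = p ∧ pushout.inr i g ≫ d = 0 :=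
    ⟨pushout.desc p 0 (by simp [w]), pushout.inl_desc _ _ _, pushout.inr_desc _ _ _⟩
  have hepi : Epi d := by
    have : Epi (pushout.inl i g ≫ d) := by rw [hd']; infer_instance
    exact epi_of_epi (pushout.inl i g) d
  have hex : (ShortComplex.mk (pushout.inr i g) d hd).ShortExact := by
    have key : ∀ {Z : C} (s : pushout i g ⟶ Z) (hs : pushout.inr i g ≫ s = 0),
        ∃ l : A ⟶ Z, d ≫ l = s := by
      intro Z s hs
      obtain ⟨l, hl⟩ := ses_desc hS (pushout.inl i g ≫ s)
        (by rw [pushout.condition_assoc, hs, comp_zero])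
      refine ⟨l, pushout.hom_ext ?_ ?_⟩
      · rw [reassoc_of% hd', hl]
      · rw [reassoc_of% hd, hs, zero_comp]
    exact ⟨ShortComplex.exact_of_g_is_cokernel _ (CokernelCofork.IsColimit.ofπ' _ _
      (fun {Z} s hs => ⟨(key s hs).choose, (key s hs).choose_spec⟩))⟩
  obtain ⟨r, hr⟩ := h _ _ _ _ hex
  exact ⟨pushout.inl i g ≫ r, by rw [pushout.condition_assoc, hr, Category.comp_id]⟩

lemma ext_lift {A X : C} (h : Ext1Zero A X) {E Z : C} (i : X ⟶ E) (p : E ⟶ Z) (w : i ≫ p = 0)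
    (hS : (ShortComplex.mk i p w).ShortExact) (g : A ⟶ Z) : ∃ e : A ⟶ E, e ≫ p = g := by
  have : Mono i := hS.mono_f
  have : Epi p := hS.epi_g
  obtain ⟨d, hd', hd⟩ : ∃ d : X ⟶ pullback p g, d ≫ pullback.fst p g = i ∧
      d ≫ pullback.snd p g = 0 :=
    ⟨pullback.lift i 0 (by simp [w]), pullback.lift_fst _ _ _, pullback.lift_snd _ _ _⟩
  have hmono : Mono d := by
    have : Mono (d ≫ pullback.fst p g) := by rw [hd']; infer_instance
    exact mono_of_mono d (pullback.fst p g)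
  have hex : (ShortComplex.mk d (pullback.snd p g) hd).ShortExact := by
    have key : ∀ {Y : C} (s : Y ⟶ pullback p g) (hs : s ≫ pullback.snd p g = 0),
        ∃ l : Y ⟶ X, l ≫ d = s := by
      intro Y s hs
      obtain ⟨l, hl⟩ := ses_lift hS (s ≫ pullback.fst p g)
        (by rw [Category.assoc, pullback.condition, reassoc_of% hs, zero_comp])
      refine ⟨l, pullback.hom_ext ?_ ?_⟩
      · rw [Category.assoc, hd', hl]
      · rw [Category.assoc, hd, hs, comp_zero]
    exact ⟨ShortComplex.exact_of_f_is_kernel _ (KernelFork.IsLimit.ofι' _ _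
      (fun {Z} s hs => ⟨(key s hs).choose, (key s hs).choose_spec⟩))⟩
  obtain ⟨r, hr⟩ := h _ _ _ _ hex
  let sp := ShortComplex.Splitting.ofExactOfRetraction _ hex.exact r hr hex.epi_g
  refine ⟨sp.s ≫ pullback.fst p g, ?_⟩
  have := sp.s_g
  dsimp at this
  rw [Category.assoc, pullback.condition, reassoc_of% this]

lemma ext_of_section {A X : C} (h : ∀ (E : C) (i : X ⟶ E) (p : E ⟶ A) (w : i ≫ p = 0),
    (ShortComplex.mk i p w).ShortExact → ∃ s : A ⟶ E, s ≫ p = 𝟙 A) : Ext1Zero A X := by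
  intro E i p w hS
  obtain ⟨s, hs⟩ := h E i p w hS
  let sp := ShortComplex.Splitting.ofExactOfSection _ hS.exact s hs hS.mono_f
  exact ⟨sp.r, sp.f_r⟩

lemma ext_section {A X : C} (h : Ext1Zero A X) (E : C) (i : X ⟶ E) (p : E ⟶ A) (w : i ≫ p = 0)
    (hS : (ShortComplex.mk i p w).ShortExact) : ∃ s : A ⟶ E, s ≫ p = 𝟙 A :=
  ext_lift h i p w hS _

lemma ext_retract_left {A B X : C} (h : Ext1Zero A X) (hB : IsSummand B A) : Ext1Zero B X := by
  obtain ⟨i, r, hir⟩ := hB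
  apply ext_of_section
  intro E j p w hS
  obtain ⟨e, he⟩ := ext_lift h j p w hS r
  exact ⟨i ≫ e, by rw [Category.assoc, he, hir]⟩

lemma ext_retract_right {A X Y : C} (h : Ext1Zero A X) (hY : IsSummand Y X) : Ext1Zero A Y := by
  obtain ⟨i, r, hir⟩ := hY
  intro E j p w hS
  obtain ⟨e, he⟩ := ext_ext h j p w hS i
  exact ⟨e ≫ r, by rw [← Category.assoc, he, hir]⟩

lemma ext_sum_left {A B X : C} (h : Ext1Zero A X) (h' : Ext1Zero B X) : Ext1Zero (A ⊞ B) X := by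
  apply ext_of_section
  intro E j p w hS
  obtain ⟨e, he⟩ := ext_lift h j p w hS biprod.inl
  obtain ⟨e', he'⟩ := ext_lift h' j p w hS biprod.inr
  exact ⟨biprod.desc e e', by apply biprod.hom_ext' <;> simp [he, he']⟩

lemma ext_sum_right {A X Y : C} (h : Ext1Zero A X) (h' : Ext1Zero A Y) : Ext1Zero A (X ⊞ Y) := by
  intro E j p w hS
  obtain ⟨e, he⟩ := ext_ext h j p w hS biprod.fst
  obtain ⟨e', he'⟩ := ext_ext h' j p w hS biprod.snd
  exact ⟨biprod.lift e e', by apply biprod.hom_ext <;> simp [he, he']⟩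

lemma ext_zero_left {A X : C} (h : IsZero A) : Ext1Zero A X := by
  apply ext_of_section
  intro E j p w hS
  exact ⟨0, h.eq_of_src _ _⟩

lemma ext_zero_right {A X : C} (h : IsZero X) : Ext1Zero A X := by
  intro E j p w hS
  exact ⟨0, h.eq_of_src _ _⟩

lemma IsSummand.refl (X : C) : IsSummand X X := ⟨𝟙 X, 𝟙 X, by simp⟩

lemma IsSummand.of_iso {X Y : C} (e : X ≅ Y) : IsSummand X Y := ⟨e.hom, e.inv, by simp⟩

lemma IsSummand.trans {X Y Z : C} (h : IsSummand X Y) (h' : IsSummand Y Z) : IsSummand X Z := by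
  obtain ⟨i, r, hir⟩ := h
  obtain ⟨i', r', hir'⟩ := h'
  exact ⟨i ≫ i', r' ≫ r, by rw [Category.assoc, reassoc_of% hir', hir]⟩

lemma summand_inl (X Y : C) : IsSummand X (X ⊞ Y) := ⟨biprod.inl, biprod.fst, by simp⟩
lemma summand_inr (X Y : C) : IsSummand Y (X ⊞ Y) := ⟨biprod.inr, biprod.snd, by simp⟩

lemma summand_biproduct {n : ℕ} (f : Fin n → C) (i : Fin n) : IsSummand (f i) (⨁ f) :=
  ⟨biproduct.ι f i, biproduct.π f i, by simp⟩

lemma summand_zero {X Y : C} (h : IsZero X) : IsSummand X Y := ⟨0, 0, h.eq_of_src _ _⟩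

lemma biproduct_ind (P : C → Prop) (h0 : P 0) (hs : ∀ X Y, P X → P Y → P (X ⊞ Y))
    (hr : ∀ X Y, P X → IsSummand Y X → P Y) {n : ℕ} (f : Fin n → C) (hf : ∀ i, P (f i)) :
    P (⨁ f) := by
  induction n with
  | zero =>
    refine hr _ _ h0 (summand_zero ?_)
    rw [IsZero.iff_id_eq_zero]
    apply biproduct.hom_ext
    intro j; exact j.elim0
  | succ n ih =>
    refine hr _ _ (hs _ _ (hf 0) (ih (fun j => f j.succ) (fun j => hf _))) ?_
    refine ⟨biprod.lift (biproduct.π f 0) (biproduct.lift fun j => biproduct.π f j.succ),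
      biprod.desc (biproduct.ι f 0) (biproduct.desc fun j => biproduct.ι f j.succ), ?_⟩
    rw [biprod.lift_desc, biproduct.lift_desc, ← biproduct.total, Fin.sum_univ_succ]

end AbCat

section Coc

/-- vertex as an object of the path category -/
abbrev vo {Q : FinQuiver} (v : Q.V) : Paths Q.V := (Paths.of Q.V).obj v

/-- arrow as a morphism of the path category -/
abbrev ao {Q : FinQuiver} {x y : Q.V} (a : x ⟶ y) : vo x ⟶ vo y := (Paths.of Q.V).map a

lemma nat_of_arrows {M X : RepC k Q} (h : ∀ v : Paths Q.V, M.obj v ⟶ X.obj v)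
    (hn : ∀ (x y : Q.V) (a : x ⟶ y), M.map (ao a) ≫ h (vo y) = h (vo x) ≫ X.map (ao a))
    {x y : Paths Q.V} (f : x ⟶ y) : M.map f ≫ h y = h x ≫ X.map f := by
  induction f using Paths.induction with
  | id => simp
  | comp p q hp =>
    rw [Functor.map_comp, Functor.map_comp, Category.assoc, hn, reassoc_of% hp]

/-- natural transformation from arrows -/
def mkNat {M X : RepC k Q} (h : ∀ v : Paths Q.V, M.obj v ⟶ X.obj v)
    (hn : ∀ (x y : Q.V) (a : x ⟶ y), M.map (ao a) ≫ h (vo y) = h (vo x) ≫ X.map (ao a)) :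
    M ⟶ X where
  app := h
  naturality _ _ f := nat_of_arrows h hn f

/-- cocycle form of vanishing of Ext -/
def Coc (M X : RepC k Q) : Prop :=
  ∀ φ : (∀ (x y : Q.V) (_ : x ⟶ y), M.obj (vo x) ⟶ X.obj (vo y)),
    ∃ h : ∀ v : Paths Q.V, M.obj v ⟶ X.obj v, ∀ (x y : Q.V) (a : x ⟶ y),
      φ x y a = h (vo x) ≫ X.map (ao a) - M.map (ao a) ≫ h (vo y)

lemma mod_section {A B : ModuleCat.{0} k} (p : A ⟶ B) (hp : Epi p) : ∃ s : B ⟶ A, s ≫ p = 𝟙 B := by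
  rw [ModuleCat.epi_iff_range_eq_top] at hp
  have : Module.Projective k B := Module.Projective.of_free
  obtain ⟨s, hs⟩ := p.hom.exists_rightInverse_of_surjective hp
  exact ⟨ModuleCat.ofHom s, by ext x; exact LinearMap.congr_fun hs x⟩

lemma mod_retr {A B : ModuleCat.{0} k} (p : A ⟶ B) (hp : Mono p) : ∃ s : B ⟶ A, p ≫ s = 𝟙 A := by
  rw [ModuleCat.mono_iff_ker_eq_bot] at hp
  obtain ⟨s, hs⟩ := p.hom.exists_leftInverse_of_injective hp
  exact ⟨ModuleCat.ofHom s, by ext x; exact LinearMap.congr_fun hs x⟩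

lemma coc_mono {I M X : RepC k Q} (h : Coc M X) (j : I ⟶ M) [Mono j] : Coc I X := by
  intro φ
  have hj := fun v => mod_retr (j.app v) inferInstance
  choose r hr using hj
  obtain ⟨h', hh⟩ := h (fun x y a => r (vo x) ≫ φ x y a)
  refine ⟨fun v => j.app v ≫ h' v, fun x y a => ?_⟩
  have := congrArg (fun t => j.app (vo x) ≫ t) (hh x y a)
  simp only [Preadditive.comp_sub] at this
  rw [reassoc_of% (hr (vo x))] at this
  rw [this, Category.assoc, NatTrans.naturality_assoc]

lemma coc_epi {M X Y : RepC k Q} (h : Coc M X) (j : X ⟶ Y) [Epi j] : Coc M Y := by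
  intro φ
  have hj := fun v => mod_section (j.app v) inferInstance
  choose r hr using hj
  obtain ⟨h', hh⟩ := h (fun x y a => φ x y a ≫ r (vo y))
  refine ⟨fun v => h' v ≫ j.app v, fun x y a => ?_⟩
  have := congrArg (fun t => t ≫ j.app (vo y)) (hh x y a)
  simp only [Preadditive.sub_comp, Category.assoc] at this
  rw [hr (vo y), Category.comp_id] at this
  rw [this, Category.assoc, NatTrans.naturality]

lemma mono_app {X Y : RepC k Q} (f : X ⟶ Y) (h : ∀ v, Mono (f.app v)) : Mono f :=
  NatTrans.mono_of_mono_app f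

lemma ses_eval {X E M : RepC k Q} {i : X ⟶ E} {p : E ⟶ M} {w : i ≫ p = 0}
    (hS : (ShortComplex.mk i p w).ShortExact) (v : Paths Q.V) :
    (ShortComplex.mk (i.app v) (p.app v) (by rw [← NatTrans.comp_app, w]; rfl)).ShortExact :=
  hS.map_of_exact ((evaluation _ _).obj v)

lemma ext_of_coc {M X : RepC k Q} (h : Coc M X) : Ext1Zero M X := by
  apply ext_of_section
  intro E i p w hS
  have := hS.epi_g
  have := hS.mono_f
  dsimp at *
  have hj := fun v => mod_section (p.app v) inferInstance
  choose s hs using hj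
  have hl : ∀ (x y : Q.V) (a : x ⟶ y), ∃ l : M.obj (vo x) ⟶ X.obj (vo y),
      l ≫ i.app (vo y) = s (vo x) ≫ E.map (ao a) - M.map (ao a) ≫ s (vo y) := by
    intro x y a
    apply ses_lift (ses_eval hS (vo y))
    rw [Preadditive.sub_comp, Category.assoc, Category.assoc, hs, NatTrans.naturality,
      reassoc_of% (hs (vo x)), Category.comp_id, sub_self]
  choose φ hφ using hl
  obtain ⟨h', hh⟩ := h φ
  refine ⟨mkNat (fun v => s v - h' v ≫ i.app v) ?_, ?_⟩
  · intro x y a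
    have h1 := hφ x y a
    rw [hh x y a] at h1
    simp only [Preadditive.sub_comp, Preadditive.comp_sub, Category.assoc, NatTrans.naturality]
      at h1 ⊢
    rw [sub_eq_sub_iff_add_eq_add] at h1 ⊢
    rw [add_comm, ← h1, add_comm]
  · ext v : 2
    have h0 : i.app v ≫ p.app v = 0 := by rw [← NatTrans.comp_app, w]; rfl
    simp [mkNat, hs, h0, Preadditive.sub_comp]

lemma lift_map_ao (F : Q.V ⥤q ModuleCat.{0} k) {x y : Q.V} (a : x ⟶ y) :
    (Paths.lift F).map (ao a) = F.map a := Paths.lift_toPath F a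

lemma twisted {M X : RepC k Q} (φ : (∀ (x y : Q.V) (_ : x ⟶ y), M.obj (vo x) ⟶ X.obj (vo y))) :
    ∃ (E : RepC k Q) (il : ∀ v, X.obj v ⟶ E.obj v) (ir : ∀ v, M.obj v ⟶ E.obj v)
      (pl : ∀ v, E.obj v ⟶ X.obj v) (pr : ∀ v, E.obj v ⟶ M.obj v),
      (∀ v, il v ≫ pl v = 𝟙 _) ∧ (∀ v, ir v ≫ pr v = 𝟙 _) ∧ (∀ v, il v ≫ pr v = 0) ∧
      (∀ v, pl v ≫ il v + pr v ≫ ir v = 𝟙 _) ∧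
      (∀ (x y : Q.V) (a : x ⟶ y), il (vo x) ≫ E.map (ao a) = X.map (ao a) ≫ il (vo y)) ∧
      (∀ (x y : Q.V) (a : x ⟶ y), ir (vo x) ≫ E.map (ao a) =
        φ x y a ≫ il (vo y) + M.map (ao a) ≫ ir (vo y)) := by
  let F : Q.V ⥤q ModuleCat.{0} k :=
    { obj := fun v => X.obj (vo v) ⊞ M.obj (vo v)
      map := fun {x y} a => biprod.desc (X.map (ao a) ≫ biprod.inl)
        (φ x y a ≫ biprod.inl + M.map (ao a) ≫ biprod.inr) }
  refine ⟨Paths.lift F, fun v => (biprod.inl : X.obj v ⟶ X.obj v ⊞ M.obj v),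
    fun v => (biprod.inr : M.obj v ⟶ X.obj v ⊞ M.obj v),
    fun v => (biprod.fst : X.obj v ⊞ M.obj v ⟶ X.obj v),
    fun v => (biprod.snd : X.obj v ⊞ M.obj v ⟶ M.obj v),
    fun v => biprod.inl_fst, fun v => biprod.inr_snd, fun v => biprod.inl_snd,
    fun v => biprod.total, fun x y a => ?_, fun x y a => ?_⟩
  · rw [lift_map_ao]
    exact biprod.inl_desc _ _
  · rw [lift_map_ao]
    exact biprod.inr_desc _ _

lemma coc_of_ext {M X : RepC k Q} (h : Ext1Zero M X) : Coc M X := by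
  intro φ
  obtain ⟨E, il, ir, pl, pr, h1, h2, h3, h4, h5, h6⟩ := twisted φ
  let i : X ⟶ E := mkNat il (fun x y a => (h5 x y a).symm)
  let p : E ⟶ M := mkNat pr (by
    intro x y a
    have h7 : (pl (vo x) ≫ il (vo x) + pr (vo x) ≫ ir (vo x)) ≫ E.map (ao a) ≫ pr (vo y) =
      E.map (ao a) ≫ pr (vo y) := by rw [h4, Category.id_comp]
    rw [← h7]
    simp only [Preadditive.add_comp, Category.assoc]
    rw [reassoc_of% h5, reassoc_of% h6]
    simp [h3, h2])
  have hi : ∀ v, i.app v = il v := fun v => rfl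
  have hp : ∀ v, p.app v = pr v := fun v => rfl
  have hmi : ∀ v, Mono (i.app v) := fun v => by
    rw [hi]; exact mono_of_mono_fac (h1 v)
  have hep : ∀ v, Epi (p.app v) := fun v => by
    rw [hp]; exact epi_of_epi_fac (h2 v)
  have : Mono i := NatTrans.mono_of_mono_app i
  have : Epi p := NatTrans.epi_of_epi_app p
  have w : i ≫ p = 0 := by
    ext v : 2
    rw [NatTrans.comp_app, hi, hp, h3]
    rfl
  have key : ∀ {Z : RepC k Q} (s : Z ⟶ E) (hs : s ≫ p = 0), ∃ l : Z ⟶ X, l ≫ i = s := by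
    intro Z s hs
    have hl : ∀ v, (s.app v ≫ pl v) ≫ i.app v = s.app v := by
      intro v
      have h0 : s.app v ≫ p.app v = 0 := by rw [← NatTrans.comp_app, hs]; rfl
      rw [hp] at h0
      rw [hi, Category.assoc, eq_sub_of_add_eq (h4 v), Preadditive.comp_sub, reassoc_of% h0]
      simp
    refine ⟨mkNat (fun v => s.app v ≫ pl v) ?_, ?_⟩
    · intro x y a
      rw [← cancel_mono (i.app (vo y)), Category.assoc, hl, Category.assoc, i.naturality,
        ← Category.assoc (s.app (vo x) ≫ pl (vo x)), hl, s.naturality]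
    · ext v : 2
      exact hl v
  have hS : (ShortComplex.mk i p w).ShortExact :=
    ⟨ShortComplex.exact_of_f_is_kernel _ (KernelFork.IsLimit.ofι' _ _
      (fun {Z} s hs => ⟨(key s hs).choose, (key s hs).choose_spec⟩))⟩
  obtain ⟨r, hr⟩ := h _ _ _ _ hS
  refine ⟨fun v => ir v ≫ r.app v, fun x y a => ?_⟩
  have h3 : il (vo y) ≫ r.app (vo y) = 𝟙 _ := by
    have := congrArg (fun t => t.app (vo y)) hr
    exact this
  rw [eq_sub_iff_add_eq, Category.assoc, ← r.naturality, reassoc_of% h6, Preadditive.add_comp,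
    Category.assoc, Category.assoc, h3, Category.comp_id]

lemma ext_mono {I M X : RepC k Q} (h : Ext1Zero M X) (j : I ⟶ M) [Mono j] : Ext1Zero I X :=
  ext_of_coc (coc_mono (coc_of_ext h) j)

lemma ext_epi {M X Y : RepC k Q} (h : Ext1Zero M X) (j : X ⟶ Y) [Epi j] : Ext1Zero M Y :=
  ext_of_coc (coc_epi (coc_of_ext h) j)

end Coc

section Dim

lemma fd_mono {X Y : RepC k Q} (f : X ⟶ Y) [Mono f] (h : FinDim Y) : FinDim X := fun v => by
  have := h v
  exact Module.Finite.of_injective (f.app (vo v)).hom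
    ((ModuleCat.mono_iff_injective _).1 inferInstance)

lemma fd_epi {X Y : RepC k Q} (f : X ⟶ Y) [Epi f] (h : FinDim X) : FinDim Y := fun v => by
  have := h v
  exact Module.Finite.of_surjective (f.app (vo v)).hom
    ((ModuleCat.epi_iff_surjective _).1 inferInstance)

lemma fd_summand {X Y : RepC k Q} (hs : IsSummand X Y) (h : FinDim Y) : FinDim X := by
  obtain ⟨i, r, hir⟩ := hs
  have : Mono i := mono_of_mono_fac hir
  exact fd_mono i h

/-- total dimension -/
def td (M : RepC k Q) : ℕ := ∑ v : Q.V, Module.finrank k (M.obj (vo v))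

lemma td_mono {X Y : RepC k Q} (f : X ⟶ Y) [Mono f] (h : FinDim Y) : td X ≤ td Y :=
  Finset.sum_le_sum fun v _ => by
    have := h v
    exact LinearMap.finrank_le_finrank_of_injective (f := (f.app (vo v)).hom)
      ((ModuleCat.mono_iff_injective _).1 inferInstance)

lemma td_epi {X Y : RepC k Q} (f : X ⟶ Y) [Epi f] (h : FinDim X) : td Y ≤ td X :=
  Finset.sum_le_sum fun v _ => by
    have := h v
    exact LinearMap.finrank_le_finrank_of_surjective (f := (f.app (vo v)).hom)
      ((ModuleCat.epi_iff_surjective _).1 inferInstance)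

lemma iso_of_mono {X Y : RepC k Q} (f : X ⟶ Y) [Mono f] (h : FinDim Y) (hd : td Y ≤ td X) :
    IsIso f := by
  have hX := fd_mono f h
  have h1 : ∀ v ∈ (Finset.univ : Finset Q.V), Module.finrank k (X.obj (vo v)) ≤
      Module.finrank k (Y.obj (vo v)) := fun v _ => by
    have := h v
    exact LinearMap.finrank_le_finrank_of_injective (f := (f.app (vo v)).hom)
      ((ModuleCat.mono_iff_injective _).1 inferInstance)
  have h2 := (Finset.sum_eq_sum_iff_of_le h1).1 (le_antisymm (Finset.sum_le_sum h1) hd)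
  have : ∀ v : Q.V, Epi (f.app (vo v)) := fun v => by
    have := h v
    have := hX v
    rw [ModuleCat.epi_iff_surjective]
    exact (LinearMap.injective_iff_surjective_of_finrank_eq_finrank
      (h2 v (Finset.mem_univ _)) (f := (f.app (vo v)).hom)).1
      ((ModuleCat.mono_iff_injective _).1 inferInstance)
  have : ∀ v, Epi (f.app v) := this
  have : Epi f := NatTrans.epi_of_epi_app f
  exact isIso_of_mono_of_epi f

lemma iso_of_epi {X Y : RepC k Q} (f : X ⟶ Y) [Epi f] (h : FinDim X) (hd : td X ≤ td Y) :
    IsIso f := by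
  have hY := fd_epi f h
  have h1 : ∀ v ∈ (Finset.univ : Finset Q.V), Module.finrank k (Y.obj (vo v)) ≤
      Module.finrank k (X.obj (vo v)) := fun v _ => by
    have := h v
    exact LinearMap.finrank_le_finrank_of_surjective (f := (f.app (vo v)).hom)
      ((ModuleCat.epi_iff_surjective _).1 inferInstance)
  have h2 := (Finset.sum_eq_sum_iff_of_le h1).1 (le_antisymm (Finset.sum_le_sum h1) hd)
  have : ∀ v : Q.V, Mono (f.app (vo v)) := fun v => by
    have := h v
    have := hY v
    rw [ModuleCat.mono_iff_injective]
    exact (LinearMap.injective_iff_surjective_of_finrank_eq_finrank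
      (h2 v (Finset.mem_univ _)).symm (f := (f.app (vo v)).hom)).2
      ((ModuleCat.epi_iff_surjective _).1 inferInstance)
  have : ∀ v, Mono (f.app v) := this
  have : Mono f := NatTrans.mono_of_mono_app f
  exact isIso_of_mono_of_epi f

lemma fd_sum {X Y : RepC k Q} (hX : FinDim X) (hY : FinDim Y) : FinDim (X ⊞ Y) := fun v => by
  have := hX v
  have := hY v
  refine Module.Finite.of_injective (LinearMap.prod ((biprod.fst : X ⊞ Y ⟶ X).app (vo v)).hom
    ((biprod.snd : X ⊞ Y ⟶ Y).app (vo v)).hom) ?_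
  rw [injective_iff_map_eq_zero]
  intro x hx
  have h1 : ((biprod.fst : X ⊞ Y ⟶ X).app (vo v)).hom x = 0 := congrArg Prod.fst hx
  have h2 : ((biprod.snd : X ⊞ Y ⟶ Y).app (vo v)).hom x = 0 := congrArg Prod.snd hx
  have h3 := congrArg (fun t => (t.app (vo v)).hom x) (biprod.total (X := X) (Y := Y))
  simp only [NatTrans.app_add, ModuleCat.hom_add, LinearMap.add_apply, NatTrans.comp_app,
    ModuleCat.hom_comp, LinearMap.comp_apply, h1, h2, map_zero, add_zero] at h3
  exact h3.symm

lemma fd_zero : FinDim (0 : RepC k Q) := fun v => by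
  have h : (𝟙 (0 : RepC k Q)) = 0 := (isZero_zero _).eq_of_src _ _
  have h2 : ∀ x : (0 : RepC k Q).obj (vo v), x = 0 := fun x =>
    congrArg (fun t => (t.app (vo v)).hom x) h
  have : Subsingleton ((0 : RepC k Q).obj (vo v)) := ⟨fun x y => by rw [h2 x, h2 y]⟩
  exact inferInstanceAs (Module.Finite k ((0 : RepC k Q).obj (vo v)))

lemma fd_biproduct {n : ℕ} (f : Fin n → RepC k Q) (h : ∀ i, FinDim (f i)) : FinDim (⨁ f) :=
  biproduct_ind FinDim fd_zero (fun _ _ => fd_sum) (fun _ _ h h' => fd_summand h' h) f h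

lemma hom_fin {X Y : RepC k Q} (hX : FinDim X) (hY : FinDim Y) : Module.Finite k (X ⟶ Y) := by
  have := hX
  have := hY
  let L : (X ⟶ Y) →ₗ[k] (∀ v : Q.V, X.obj (vo v) →ₗ[k] Y.obj (vo v)) :=
    { toFun := fun f v => (f.app (vo v)).hom
      map_add' := fun f g => rfl
      map_smul' := fun f g => rfl }
  have hfin : ∀ v : Q.V, Module.Finite k (X.obj (vo v) →ₗ[k] Y.obj (vo v)) := fun v => by
    have := hX v
    have := hY v
    exact Module.Finite.linearMap _ _ _ _
  refine Module.Finite.of_injective L ?_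
  intro f g hfg
  ext v : 2
  ext x
  exact LinearMap.congr_fun (congrFun hfg v) x

end Dim
section Proj

lemma paths_fin (v : Q.V) (w : Q.V) : Finite (Quiver.Path v w) := by
  let r : Q.V → Q.V → Prop := fun x y => Nonempty (x ⟶ y)
  have hpath : ∀ x y, Relation.TransGen r x y → ∃ p : Quiver.Path x y, 0 < p.length := by
    intro x y h
    induction h with
    | single h => obtain ⟨a⟩ := h; exact ⟨a.toPath, by simp⟩
    | tail _ h ih =>
      obtain ⟨p, hp⟩ := ih
      obtain ⟨a⟩ := h
      exact ⟨p.cons a, by simp⟩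
  have hirr : Std.Irrefl (Relation.TransGen r) := ⟨fun x h => by
    obtain ⟨p, hp⟩ := hpath x x h
    rw [Q.acyclic x p] at hp
    simp at hp⟩
  have hwf : WellFounded (Relation.TransGen r) := Finite.wellFounded_of_trans_of_irrefl _
  induction w using hwf.induction with
  | _ w ih =>
    have : ∀ u : {u : Q.V // Nonempty (u ⟶ w)}, Finite (Quiver.Path v u) :=
      fun u => ih u (Relation.TransGen.single u.2)
    let F : Option (Σ u : {u : Q.V // Nonempty (u ⟶ w)}, Quiver.Path v u.1 × (u.1 ⟶ w)) →
      Set (Quiver.Path v w) := fun o => match o with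
        | none => {p | p.length = 0}
        | some ⟨u, p, a⟩ => {p.cons a}
    have hF : ∀ o, (F o).Finite := by
      intro o
      match o with
      | none =>
        apply Set.Subsingleton.finite
        intro p hp q hq
        have hp : p.length = 0 := hp
        have hq : q.length = 0 := hq
        have := Quiver.Path.eq_of_length_zero p hp
        subst this
        rw [Quiver.Path.eq_nil_of_length_zero p hp, Quiver.Path.eq_nil_of_length_zero q hq]
      | some ⟨u, p, a⟩ => exact Set.finite_singleton _
    have hU : (⋃ o, F o) = Set.univ := by
      rw [Set.eq_univ_iff_forall]
      intro p
      rw [Set.mem_iUnion]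
      cases p with
      | nil => exact ⟨none, rfl⟩
      | cons p a => exact ⟨some ⟨⟨_, ⟨a⟩⟩, p, a⟩, rfl⟩
    rw [← Set.finite_univ_iff, ← hU]
    exact Set.finite_iUnion hF

/-- paths into a vertex -/
def pathFun (Q : FinQuiver) : Paths Q.V ⥤ Type where
  obj w := Σ v : Paths Q.V, (v ⟶ w)
  map f := ↾(fun p => ⟨p.1, p.2 ≫ f⟩)

/-- the projective generator -/
def PG (k : Type) [Field k] (Q : FinQuiver) : RepC k Q := pathFun Q ⋙ ModuleCat.free k

def pgen (v : Paths Q.V) : (PG k Q).obj v := ModuleCat.freeMk (R := k) (⟨v, 𝟙 v⟩ : Σ u : Paths Q.V, (u ⟶ v))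

lemma pg_fd : FinDim (PG k Q) := fun v => by
  have : ∀ u : Paths Q.V, Finite (u ⟶ vo v) := fun u => paths_fin (Q := Q) u v
  have : Finite (Paths Q.V) := inferInstanceAs (Finite Q.V)
  have : Finite (Σ u : Paths Q.V, (u ⟶ vo v)) := inferInstance
  exact inferInstanceAs (Module.Finite k ((Σ u : Paths Q.V, (u ⟶ vo v)) →₀ k))

lemma pg_ext {X : RepC k Q} (f g : PG k Q ⟶ X)
    (h : ∀ v, (f.app v).hom (pgen v) = (g.app v).hom (pgen v)) : f = g := by
  ext w : 2
  apply ModuleCat.free_hom_ext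
  rintro ⟨v, p⟩
  have hp : (ModuleCat.freeMk (R := k) (⟨v, p⟩ : Σ u : Paths Q.V, (u ⟶ w))) =
      ((PG k Q).map p).hom (pgen v) := by
    have := ModuleCat.free_map_apply (R := k) ((pathFun Q).map p) ⟨v, 𝟙 v⟩
    refine Eq.trans ?_ this.symm
    congr 1
    exact (congrArg (fun t => (⟨v, t⟩ : Σ u : Paths Q.V, (u ⟶ w))) (Category.id_comp p)).symm
  have h1 := LinearMap.congr_fun (congrArg ModuleCat.Hom.hom (f.naturality p)) (pgen v)
  have h2 := LinearMap.congr_fun (congrArg ModuleCat.Hom.hom (g.naturality p)) (pgen v)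
  have h3 := congrArg ((X.map p).hom) (h v)
  have h4 : (f.app w).hom (((PG k Q).map p).hom (pgen v)) = (g.app w).hom (((PG k Q).map p).hom (pgen v)) :=
    h1.trans (h3.trans h2.symm)
  rw [← hp] at h4
  exact h4

lemma pg_desc {X : RepC k Q} (x : ∀ v, X.obj v) : ∃ f : PG k Q ⟶ X,
    ∀ v, (f.app v).hom (pgen v) = x v := by
  have hd : ∀ w, ∃ d : (PG k Q).obj w ⟶ X.obj w, ∀ p : (Σ u : Paths Q.V, (u ⟶ w)),
      d.hom (ModuleCat.freeMk (R := k) p) = (X.map p.2).hom (x p.1) := fun w =>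
    ⟨ModuleCat.freeDesc (↾(fun p : Σ u : Paths Q.V, (u ⟶ w) => (X.map p.2).hom (x p.1))),
      fun p => ModuleCat.freeDesc_apply _ _⟩
  choose d hd using hd
  refine ⟨{ app := d, naturality := ?_ }, ?_⟩
  · intro w w' f
    apply ModuleCat.free_hom_ext
    rintro ⟨v, p⟩
    have h1 : ((PG k Q).map f).hom (ModuleCat.freeMk (R := k) (⟨v, p⟩ : Σ u : Paths Q.V, (u ⟶ w))) =
      (ModuleCat.freeMk (R := k) (⟨v, p ≫ f⟩ : Σ u : Paths Q.V, (u ⟶ w'))) :=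
      ModuleCat.free_map_apply (R := k) ((pathFun Q).map f) ⟨v, p⟩
    change (d w').hom (((PG k Q).map f).hom (ModuleCat.freeMk (R := k) (⟨v, p⟩ : Σ u : Paths Q.V, (u ⟶ w)))) = (X.map f).hom ((d w).hom (ModuleCat.freeMk (R := k) (⟨v, p⟩ : Σ u : Paths Q.V, (u ⟶ w))))
    rw [h1, hd]
    refine (hd w' ⟨v, p ≫ f⟩).trans ?_
    change (X.map (p ≫ f)).hom (x v) = (X.map f).hom ((X.map p).hom (x v))
    rw [X.map_comp]
    rfl
  · intro v
    refine (hd v ⟨v, 𝟙 v⟩).trans ?_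
    change (X.map (𝟙 v)).hom (x v) = x v
    simp

lemma pg_lift {X Y : RepC k Q} (e : X ⟶ Y) [Epi e] (f : PG k Q ⟶ Y) : ∃ g : PG k Q ⟶ X, g ≫ e = f := by
  have hs : ∀ v, ∃ x, (e.app v).hom x = (f.app v).hom (pgen v) := fun v =>
    (ModuleCat.epi_iff_surjective _).1 inferInstance _
  choose x hx using hs
  obtain ⟨g, hg⟩ := pg_desc x
  refine ⟨g, pg_ext _ _ fun v => ?_⟩
  rw [NatTrans.comp_app, ModuleCat.hom_comp, LinearMap.comp_apply, hg, hx]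

lemma pg_sep {X Y : RepC k Q} (e : X ⟶ Y) (h : ∀ g : PG k Q ⟶ X, g ≫ e = 0) : e = 0 := by
  classical
  ext v : 2
  ext x
  obtain ⟨g, hg⟩ := pg_desc (X := X) (fun w => if h : w = v then h ▸ x else 0)
  have h1 : ((g ≫ e).app v).hom (pgen v) = 0 := by rw [h g]; rfl
  rw [NatTrans.comp_app, ModuleCat.hom_comp, LinearMap.comp_apply, hg] at h1
  simpa using h1

lemma pg_ext_zero (X : RepC k Q) : Ext1Zero (PG k Q) X := by
  apply ext_of_section
  intro E i p w hS
  have : Epi p := hS.epi_g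
  exact pg_lift p _
end Proj

section Add
variable {C : Type*} [Category C] [Abelian C]

/-- direct power -/
abbrev SB (U : C) (n : ℕ) : C := ⨁ (fun _ : Fin n => U)

lemma add_iff {U X : C} : X ∈ addSet ({U} : Set C) ↔ ∃ n, IsSummand X (SB U n) := by
  constructor
  · rintro ⟨n, f, hf, h⟩
    obtain rfl : f = fun _ => U := funext hf
    exact ⟨n, h⟩
  · rintro ⟨n, h⟩
    exact ⟨n, fun _ => U, fun _ => rfl, h⟩

lemma add_of_sum {U X : C} {ι : Type} [Fintype ι] (s : ι → (X ⟶ U)) (r : ι → (U ⟶ X))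
    (h : ∑ i, s i ≫ r i = 𝟙 X) : X ∈ addSet ({U} : Set C) := by
  rw [add_iff]
  let e := Fintype.equivFin ι
  refine ⟨Fintype.card ι, biproduct.lift (fun i => s (e.symm i)), biproduct.desc (fun i => r (e.symm i)), ?_⟩
  rw [biproduct.lift_desc, ← h]
  exact Equiv.sum_comp e.symm (fun i => s i ≫ r i)

lemma sum_of_add {U X : C} (h : X ∈ addSet ({U} : Set C)) : ∃ (n : ℕ) (s : Fin n → (X ⟶ U))
    (r : Fin n → (U ⟶ X)), ∑ i, s i ≫ r i = 𝟙 X := by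
  obtain ⟨n, i, r, hir⟩ := add_iff.1 h
  refine ⟨n, fun j => i ≫ biproduct.π _ j, fun j => biproduct.ι (fun _ : Fin n => U) j ≫ r, ?_⟩
  have : ∀ j, (i ≫ biproduct.π (fun _ : Fin n => U) j) ≫ biproduct.ι (fun _ : Fin n => U) j ≫ r =
    i ≫ (biproduct.π (fun _ : Fin n => U) j ≫ biproduct.ι (fun _ : Fin n => U) j) ≫ r := by simp
  rw [Finset.sum_congr rfl (fun j _ => this j), ← Preadditive.comp_sum, ← Preadditive.sum_comp,
    biproduct.total, Category.id_comp, hir]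

lemma add_summand {U X Y : C} (h : X ∈ addSet ({U} : Set C)) (hY : IsSummand Y X) :
    Y ∈ addSet ({U} : Set C) := by
  rw [add_iff] at *
  obtain ⟨n, h⟩ := h
  exact ⟨n, hY.trans h⟩

lemma add_self (U : C) : U ∈ addSet ({U} : Set C) :=
  add_of_sum (ι := Unit) (fun _ => 𝟙 U) (fun _ => 𝟙 U) (by simp)

lemma add_zero' {U X : C} (h : IsZero X) : X ∈ addSet ({U} : Set C) :=
  add_summand (add_self U) (summand_zero h)

lemma add_sum {U X Y : C} (h : X ∈ addSet ({U} : Set C)) (h' : Y ∈ addSet ({U} : Set C)) :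
    (X ⊞ Y) ∈ addSet ({U} : Set C) := by
  obtain ⟨n, s, r, h⟩ := sum_of_add h
  obtain ⟨m, s', r', h'⟩ := sum_of_add h'
  refine add_of_sum (ι := Fin n ⊕ Fin m) (Sum.elim (fun i => biprod.fst ≫ s i) (fun i => biprod.snd ≫ s' i))
    (Sum.elim (fun i => r i ≫ biprod.inl) (fun i => r' i ≫ biprod.inr)) ?_
  rw [Fintype.sum_sum_type]
  simp only [Sum.elim_inl, Sum.elim_inr, Category.assoc]
  rw [← Preadditive.comp_sum, ← Preadditive.comp_sum]
  simp only [← Category.assoc]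
  have h1 : (∑ x, (s x ≫ r x) ≫ (biprod.inl : X ⟶ X ⊞ Y)) = biprod.inl := by
    rw [← Preadditive.sum_comp, h, Category.id_comp]
  have h2 : (∑ x, (s' x ≫ r' x) ≫ (biprod.inr : Y ⟶ X ⊞ Y)) = biprod.inr := by
    rw [← Preadditive.sum_comp, h', Category.id_comp]
  rw [h1, h2, biprod.total]

lemma add_biproduct {U : C} {n : ℕ} (f : Fin n → C) (h : ∀ i, f i ∈ addSet ({U} : Set C)) :
    (⨁ f) ∈ addSet ({U} : Set C) :=
  biproduct_ind (· ∈ addSet ({U} : Set C)) (add_zero' (isZero_zero _)) (fun _ _ => add_sum)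
    (fun _ _ h h' => add_summand h h') f h

lemma gen_iff {U X : C} : X ∈ gen ({U} : Set C) ↔ ∃ n, ∃ p : SB U n ⟶ X, Epi p := by
  constructor
  · rintro ⟨A, hA, p, hp⟩
    obtain ⟨n, i, r, hir⟩ := add_iff.1 hA
    have : Epi r := epi_of_epi_fac hir
    exact ⟨n, r ≫ p, epi_comp _ _⟩
  · rintro ⟨n, p, hp⟩
    exact ⟨_, add_iff.2 ⟨n, IsSummand.refl _⟩, p, hp⟩

lemma gen_epi {U X Y : C} (h : X ∈ gen ({U} : Set C)) (p : X ⟶ Y) [Epi p] : Y ∈ gen ({U} : Set C) := by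
  obtain ⟨A, hA, q, hq⟩ := h
  exact ⟨A, hA, q ≫ p, epi_comp _ _⟩

lemma gen_summand {U X Y : C} (h : X ∈ gen ({U} : Set C)) (hs : IsSummand Y X) : Y ∈ gen ({U} : Set C) := by
  obtain ⟨i, r, hir⟩ := hs
  have : Epi r := epi_of_epi_fac hir
  exact gen_epi h r

lemma gen_sum {U X Y : C} (h : X ∈ gen ({U} : Set C)) (h' : Y ∈ gen ({U} : Set C)) :
    (X ⊞ Y) ∈ gen ({U} : Set C) := by
  obtain ⟨A, hA, q, hq⟩ := h
  obtain ⟨A', hA', q', hq'⟩ := h'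
  exact ⟨A ⊞ A', add_sum hA hA', biprod.map q q', inferInstance⟩

lemma gen_add {U X : C} (h : X ∈ addSet ({U} : Set C)) : X ∈ gen ({U} : Set C) :=
  ⟨X, h, 𝟙 X, inferInstance⟩

lemma gen_biproduct {U : C} {n : ℕ} (f : Fin n → C) (h : ∀ i, f i ∈ gen ({U} : Set C)) :
    (⨁ f) ∈ gen ({U} : Set C) :=
  biproduct_ind (· ∈ gen ({U} : Set C)) (gen_add (add_zero' (isZero_zero _))) (fun _ _ => gen_sum)
    (fun _ _ h h' => gen_summand h h') f h

lemma gen_trans {U V X : C} (h : X ∈ gen ({V} : Set C)) (hV : V ∈ gen ({U} : Set C)) :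
    X ∈ gen ({U} : Set C) := by
  obtain ⟨n, p, hp⟩ := gen_iff.1 h
  exact gen_epi (gen_biproduct (fun _ : Fin n => V) fun _ => hV) p

lemma ext_biproduct_left {X : C} {n : ℕ} (f : Fin n → C) (h : ∀ i, Ext1Zero (f i) X) :
    Ext1Zero (⨁ f) X :=
  biproduct_ind (Ext1Zero · X) (ext_zero_left (isZero_zero _)) (fun _ _ => ext_sum_left)
    (fun _ _ h h' => ext_retract_left h h') f h

lemma ext_biproduct_right {X : C} {n : ℕ} (f : Fin n → C) (h : ∀ i, Ext1Zero X (f i)) :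
    Ext1Zero X (⨁ f) :=
  biproduct_ind (Ext1Zero X ·) (ext_zero_right (isZero_zero _)) (fun _ _ => ext_sum_right)
    (fun _ _ h h' => ext_retract_right h h') f h

lemma ext_add_left {U X Y : C} (h : Ext1Zero U X) (hY : Y ∈ addSet ({U} : Set C)) : Ext1Zero Y X := by
  obtain ⟨n, hn⟩ := add_iff.1 hY
  exact ext_retract_left (ext_biproduct_left _ fun _ => h) hn

lemma indec_summand_s3 {X A : C} (hX : Indec X) (i : A ⟶ X) (r : X ⟶ A) (h : i ≫ r = 𝟙 A) :
    IsZero A ∨ IsIso i := by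
  have hid : (𝟙 X - r ≫ i) ≫ (𝟙 X - r ≫ i) = 𝟙 X - r ≫ i := by
    simp [reassoc_of% h]
  have : IsIdempotentComplete C := Idempotents.isIdempotentComplete_of_abelian _
  obtain ⟨B, i', r', h1, h2⟩ := IsIdempotentComplete.idempotents_split X _ hid
  have h3 : i ≫ r' = 0 := by
    have : i ≫ r' ≫ i' = 0 := by rw [h2]; simp [reassoc_of% h]
    have h4 : i ≫ r' = (i ≫ r' ≫ i') ≫ r' := by simp [h1]
    rw [h4, this, zero_comp]
  have h4 : i' ≫ r = 0 := by
    have : r' ≫ i' ≫ r = 0 := by rw [reassoc_of% h2]; simp [h]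
    have h4 : i' ≫ r = i' ≫ r' ≫ i' ≫ r := by simp [reassoc_of% h1]
    rw [h4, this, comp_zero]
  let e : X ≅ A ⊞ B :=
    { hom := biprod.lift r r'
      inv := biprod.desc i i'
      hom_inv_id := by simp [h2]
      inv_hom_id := by
        apply biprod.hom_ext' <;> apply biprod.hom_ext <;> simp [h, h1, h3, h4] }
  rcases hX.2 A B e with hz | hz
  · exact Or.inl hz
  · right
    refine ⟨r, h, ?_⟩
    have : r' = 0 := hz.eq_of_tgt _ _
    rw [this, zero_comp] at h2
    exact (sub_eq_zero.1 h2.symm).symm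

lemma indec_iso_of_summand {X A : C} (hX : Indec X) (hA : Indec A) (h : IsSummand A X) :
    Nonempty (A ≅ X) := by
  obtain ⟨i, r, h⟩ := h
  rcases indec_summand_s3 hX i r h with h | h
  · exact absurd h hA.1
  · exact ⟨asIso i⟩

end Add

section KS

lemma indec_local {X : RepC k Q} (hX : Indec X) (hf : FinDim X) : IsLocalRing (End X) := by
  have hfin : Module.Finite k (End X) := hom_fin hf hf
  have : Nontrivial (End X) := by
    refine ⟨0, 1, fun h => hX.1 ?_⟩
    rw [IsZero.iff_id_eq_zero]
    exact h.symm
  apply IsLocalRing.of_isUnit_or_isUnit_one_sub_self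
  intro a
  let L : End X →ₗ[k] End X := LinearMap.mulLeft k a
  have hL : ∀ n x, (L ^ n) x = a ^ n * x := fun n x => by
    rw [LinearMap.pow_mulLeft]; rfl
  obtain ⟨n, hn⟩ := L.eventually_isCompl_ker_pow_range_pow.exists_forall_of_atTop
  have hn := hn (n + 1) (by omega)
  set m := n + 1
  have h1 : (1 : End X) ∈ LinearMap.ker (L ^ m) ⊔ LinearMap.range (L ^ m) := by
    rw [hn.sup_eq_top]; trivial
  obtain ⟨y, hy, e, he, hye⟩ := Submodule.mem_sup.1 h1
  obtain ⟨z, hz⟩ := he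
  rw [LinearMap.mem_ker, hL] at hy
  rw [hL] at hz
  have hd : y * e = 0 ∧ e * e = e := by
    have h2 : y * e = e - e * e := by
      rw [eq_sub_iff_add_eq, ← add_mul, hye, one_mul]
    have h3 : y * e ∈ LinearMap.ker (L ^ m) := by
      rw [LinearMap.mem_ker, hL, ← mul_assoc, hy, zero_mul]
    have h4 : y * e ∈ LinearMap.range (L ^ m) := ⟨z - z * e, by rw [h2, hL, mul_sub, ← mul_assoc, hz]⟩
    have h5 : y * e = 0 := by
      have := hn.disjoint.le_bot ⟨h3, h4⟩
      simpa using this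
    exact ⟨h5, by rw [h5] at h2; exact (sub_eq_zero.1 h2.symm).symm⟩
  have hid : (e : X ⟶ X) ≫ (e : X ⟶ X) = e := hd.2
  have : IsIdempotentComplete (RepC k Q) := Idempotents.isIdempotentComplete_of_abelian _
  obtain ⟨B, i', r', h6, h7⟩ := IsIdempotentComplete.idempotents_split X _ hid
  rcases indec_summand_s3 hX i' r' h6 with h | h
  · right
    have he0 : e = 0 := by
      have : r' = 0 := h.eq_of_tgt _ _
      rw [this, zero_comp] at h7
      exact h7.symm
    rw [he0, add_zero] at hye
    rw [hye, mul_one] at hy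
    exact IsNilpotent.isUnit_one_sub ⟨m, hy⟩
  · left
    have he1 : e = 1 := by
      have h8 : i' ≫ e = i' := by rw [← h7, reassoc_of% h6]
      have h9 : i' ≫ e = i' ≫ 𝟙 X := by rw [h8, Category.comp_id]
      exact (cancel_epi i').1 h9
    have h10 : a * (a ^ n * z) = 1 := by rw [← mul_assoc, ← pow_succ', hz, he1]
    have hsurj : Function.Surjective L := fun x => ⟨a ^ n * z * x, by
      change a * (a ^ n * z * x) = x
      rw [← mul_assoc, h10, one_mul]⟩
    have hinj : Function.Injective L := LinearMap.injective_iff_surjective.2 hsurj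
    have h11 : (a ^ n * z) * a = 1 := hinj (by
      change a * ((a ^ n * z) * a) = a * 1
      rw [← mul_assoc, h10, one_mul, mul_one])
    exact ⟨⟨a, a ^ n * z, h10, h11⟩, rfl⟩

lemma indec_sum {X : RepC k Q} (hX : Indec X) (hf : FinDim X) {ι : Type} [Fintype ι]
    {Y : ι → RepC k Q} (s : ∀ i, X ⟶ Y i) (r : ∀ i, Y i ⟶ X) (h : ∑ i, s i ≫ r i = 𝟙 X) :
    ∃ i, IsSummand X (Y i) := by
  have := indec_local hX hf
  let a : ι → End X := fun i => (s i ≫ r i : X ⟶ X)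
  have h1 : IsUnit (∑ i, a i) := by
    have : ∑ i, a i = 1 := h
    rw [this]; exact isUnit_one
  obtain ⟨i, _, hi⟩ := IsLocalRing.exists_of_isUnit_sum h1
  obtain ⟨u, hu⟩ := hi
  refine ⟨i, s i, r i ≫ (u.inv : End X), ?_⟩
  have h2 : u.inv * a i = 1 := by rw [← hu]; exact u.inv_val
  rw [← Category.assoc]
  exact h2

lemma indec_biproduct {X : RepC k Q} (hX : Indec X) (hf : FinDim X) {n : ℕ}
    (Y : Fin n → RepC k Q) (h : IsSummand X (⨁ Y)) : ∃ i, IsSummand X (Y i) := by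
  obtain ⟨i, r, hir⟩ := h
  refine indec_sum hX hf (fun j => i ≫ biproduct.π _ j) (fun j => biproduct.ι Y j ≫ r) ?_
  have : ∀ j, (i ≫ biproduct.π Y j) ≫ biproduct.ι Y j ≫ r =
    i ≫ (biproduct.π Y j ≫ biproduct.ι Y j) ≫ r := by simp
  rw [Finset.sum_congr rfl (fun j _ => this j), ← Preadditive.comp_sum, ← Preadditive.sum_comp,
    biproduct.total, Category.id_comp, hir]

lemma indec_biprod {X A B : RepC k Q} (hX : Indec X) (hf : FinDim X)
    (h : IsSummand X (A ⊞ B)) : IsSummand X A ∨ IsSummand X B := by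
  obtain ⟨i, r, hir⟩ := h
  obtain ⟨b, hb⟩ := indec_sum hX hf (ι := Bool) (Y := fun b => if b then A else B)
    (fun b => match b with
      | true => (i ≫ biprod.fst : X ⟶ A)
      | false => (i ≫ biprod.snd : X ⟶ B))
    (fun b => match b with
      | true => (biprod.inl ≫ r : A ⟶ X)
      | false => (biprod.inr ≫ r : B ⟶ X)) (by
      rw [Fintype.sum_bool]
      change (i ≫ biprod.fst) ≫ biprod.inl ≫ r + (i ≫ biprod.snd) ≫ biprod.inr ≫ r = 𝟙 X
      have := congrArg (fun t => i ≫ t ≫ r) (biprod.total (X := A) (Y := B))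
      simp only [Preadditive.add_comp, Preadditive.comp_add, Category.id_comp, hir] at this
      simpa using this)
  cases b
  · right; exact hb
  · left; exact hb

lemma fd_ind (P : RepC k Q → Prop) (h0 : ∀ X, IsZero X → P X) (h1 : ∀ X, FinDim X → Indec X → P X)
    (h2 : ∀ X A B, FinDim A → FinDim B → Nonempty (X ≅ A ⊞ B) → P A → P B → P X) (X : RepC k Q) (hX : FinDim X) :
    P X := by
  induction hn : td X using Nat.strong_induction_on generalizing X with
  | _ n ih =>
    by_cases hz : IsZero X
    · exact h0 X hz
    by_cases hi : Indec X
    · exact h1 X hX hi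
    have : ∃ A B, Nonempty (X ≅ A ⊞ B) ∧ ¬ IsZero A ∧ ¬ IsZero B := by
      by_contra hc
      push Not at hc
      refine hi ⟨hz, fun A B e => ?_⟩
      by_contra h
      rw [not_or] at h
      exact h.2 (hc A B ⟨e⟩ h.1)
    obtain ⟨A, B, ⟨e⟩, hA, hB⟩ := this
    have fA : FinDim A := fd_summand ((summand_inl A B).trans (IsSummand.of_iso e.symm)) hX
    have fB : FinDim B := fd_summand ((summand_inr A B).trans (IsSummand.of_iso e.symm)) hX
    have tA : td A < td X := by
      by_contra hc
      have := iso_of_mono (biprod.inl ≫ e.inv) hX (not_lt.1 hc)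
      have h3 : IsIso (biprod.inl : A ⟶ A ⊞ B) := IsIso.of_isIso_comp_right _ e.inv
      apply hB
      rw [IsZero.iff_id_eq_zero]
      have h4 : (biprod.snd : A ⊞ B ⟶ B) = 0 := by
        rw [← cancel_epi (biprod.inl : A ⟶ A ⊞ B)]; simp
      rw [← biprod.inr_snd (X := A), h4, comp_zero]
    have tB : td B < td X := by
      by_contra hc
      have := iso_of_mono (biprod.inr ≫ e.inv) hX (not_lt.1 hc)
      have h3 : IsIso (biprod.inr : B ⟶ A ⊞ B) := IsIso.of_isIso_comp_right _ e.inv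
      apply hA
      rw [IsZero.iff_id_eq_zero]
      have h4 : (biprod.fst : A ⊞ B ⟶ A) = 0 := by
        rw [← cancel_epi (biprod.inr : B ⟶ A ⊞ B)]; simp
      rw [← biprod.inl_fst (Y := B), h4, comp_zero]
    exact h2 X A B fA fB ⟨e⟩ (ih _ (hn ▸ tA) A fA rfl) (ih _ (hn ▸ tB) B fB rfl)

lemma add_of_indec {U : RepC k Q} (X : RepC k Q) (hX : FinDim X)
    (h : ∀ Y, Indec Y → IsSummand Y X → Y ∈ addSet ({U} : Set (RepC k Q))) :
    X ∈ addSet ({U} : Set (RepC k Q)) := by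
  refine fd_ind (fun X => (∀ Y, Indec Y → IsSummand Y X → Y ∈ addSet ({U} : Set (RepC k Q))) →
    X ∈ addSet ({U} : Set (RepC k Q))) ?_ ?_ ?_ X hX h
  · intro X hX _
    exact add_zero' hX
  · intro X _ hX h
    exact h X hX (IsSummand.refl _)
  · rintro X A B _ _ ⟨e⟩ hA hB h
    refine add_summand (add_sum (hA ?_) (hB ?_)) (IsSummand.of_iso e)
    · intro Y hY hs
      exact h Y hY ((hs.trans (summand_inl A B)).trans (IsSummand.of_iso e.symm))
    · intro Y hY hs
      exact h Y hY ((hs.trans (summand_inr A B)).trans (IsSummand.of_iso e.symm))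

lemma indec_list (X : RepC k Q) (hX : FinDim X) : ∃ (n : ℕ) (f : Fin n → RepC k Q),
    (∀ i, Indec (f i) ∧ IsSummand (f i) X) ∧ (∀ i j, Nonempty (f i ≅ f j) → i = j) ∧
    (∀ P, Indec P → IsSummand P X → ∃ i, Nonempty (P ≅ f i)) := by
  let S : RepC k Q → Set (Quotient (isIsomorphicSetoid (RepC k Q))) :=
    fun X => {q | ∃ P, Indec P ∧ IsSummand P X ∧ Quotient.mk _ P = q}
  have hS : (S X).Finite := by
    refine fd_ind (fun X => (S X).Finite) ?_ ?_ ?_ X hX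
    · intro X hX
      convert Set.finite_empty
      rw [Set.eq_empty_iff_forall_notMem]
      rintro q ⟨P, hP, ⟨i, r, h⟩, -⟩
      apply hP.1
      rw [IsZero.iff_id_eq_zero, ← h, hX.eq_of_tgt i 0, zero_comp]
    · intro X _ hX
      refine (Set.finite_singleton (Quotient.mk _ X)).subset ?_
      rintro q ⟨P, hP, h, rfl⟩
      exact Quotient.sound (indec_iso_of_summand hX hP h)
    · rintro X A B fA fB ⟨e⟩ hA hB
      refine (hA.union hB).subset ?_
      rintro q ⟨P, hP, h, rfl⟩
      have h' := h.trans (IsSummand.of_iso e)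
      rcases indec_biprod hP (fd_summand h' (fd_sum fA fB)) h' with h | h
      · exact Or.inl ⟨P, hP, h, rfl⟩
      · exact Or.inr ⟨P, hP, h, rfl⟩
  have := hS.fintype
  let e := Fintype.equivFin (S X)
  choose P hP1 hP2 hP3 using fun q : S X => q.2
  refine ⟨Fintype.card (S X), fun i => P (e.symm i), fun i => ⟨hP1 _, hP2 _⟩, ?_, ?_⟩
  · intro i j h
    have : (Quotient.mk (isIsomorphicSetoid (RepC k Q)) (P (e.symm i))) = Quotient.mk _ (P (e.symm j)) :=
      Quotient.sound h
    rw [hP3, hP3] at this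
    exact e.symm.injective (Subtype.ext this)
  · intro R hR hs
    refine ⟨e ⟨Quotient.mk _ R, R, hR, hs, rfl⟩, ?_⟩
    have := hP3 ⟨Quotient.mk _ R, R, hR, hs, rfl⟩
    change Nonempty (R ≅ P (e.symm (e ⟨Quotient.mk _ R, R, hR, hs, rfl⟩)))
    rw [Equiv.symm_apply_apply]
    exact Quotient.exact this.symm

lemma list_iso {n m : ℕ} (f : Fin n → RepC k Q) (g : Fin m → RepC k Q)
    (hf : ∀ i j, Nonempty (f i ≅ f j) → i = j) (hg : ∀ i j, Nonempty (g i ≅ g j) → i = j)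
    (h1 : ∀ i, ∃ j, Nonempty (f i ≅ g j)) (h2 : ∀ j, ∃ i, Nonempty (g j ≅ f i)) :
    Nonempty ((⨁ f) ≅ (⨁ g)) := by
  choose a ha using h1
  choose b hb using h2
  let e : Fin n ≃ Fin m :=
    { toFun := a
      invFun := b
      left_inv := fun i => hf _ _ ⟨(hb (a i)).some.symm ≪≫ (ha i).some.symm⟩
      right_inv := fun i => hg _ _ ⟨(ha (b i)).some.symm ≪≫ (hb i).some.symm⟩ }
  exact ⟨biproduct.whiskerEquiv e fun j => (ha j).some.symm⟩

lemma univ_map (U X : RepC k Q) (hU : FinDim U) (hX : FinDim X) :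
    ∃ (n : ℕ) (u : SB U n ⟶ X), ∀ g : U ⟶ X, ∃ h : U ⟶ SB U n, h ≫ u = g := by
  have hfin := hom_fin hU hX
  obtain ⟨n, s, hs⟩ := Module.Finite.exists_fin (R := k) (M := U ⟶ X)
  refine ⟨n, biproduct.desc s, fun g => ?_⟩
  have : g ∈ Submodule.span k (Set.range s) := by rw [hs]; trivial
  obtain ⟨c, rfl⟩ := (Submodule.mem_span_range_iff_exists_fun k).1 this
  refine ⟨biproduct.lift fun i => c i • 𝟙 U, ?_⟩
  rw [biproduct.lift_desc]
  simp

lemma univ_map' (U X : RepC k Q) (hU : FinDim U) (hX : FinDim X) :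
    ∃ (n : ℕ) (u : X ⟶ SB U n), ∀ g : X ⟶ U, ∃ h : SB U n ⟶ U, u ≫ h = g := by
  have hfin := hom_fin hX hU
  obtain ⟨n, s, hs⟩ := Module.Finite.exists_fin (R := k) (M := X ⟶ U)
  refine ⟨n, biproduct.lift s, fun g => ?_⟩
  have : g ∈ Submodule.span k (Set.range s) := by rw [hs]; trivial
  obtain ⟨c, rfl⟩ := (Submodule.mem_span_range_iff_exists_fun k).1 this
  refine ⟨biproduct.desc fun i => c i • 𝟙 U, ?_⟩
  rw [biproduct.lift_desc]
  simp

lemma fact_SB {C : Type*} [Category C] [Abelian C] {U Y X : C} {u : Y ⟶ X} (hu : ∀ g : U ⟶ X, ∃ h : U ⟶ Y, h ≫ u = g)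
    {m : ℕ} (g : SB U m ⟶ X) : ∃ h, h ≫ u = g := by
  choose h hh using fun i => hu (biproduct.ι (fun _ : Fin m => U) i ≫ g)
  exact ⟨biproduct.desc h, by apply biproduct.hom_ext'; intro j; simp [hh]⟩

lemma fact_SB' {C : Type*} [Category C] [Abelian C] {U Y X : C} {u : X ⟶ Y} (hu : ∀ g : X ⟶ U, ∃ h : Y ⟶ U, u ≫ h = g)
    {m : ℕ} (g : X ⟶ SB U m) : ∃ h, u ≫ h = g := by
  choose h hh using fun i => hu (g ≫ biproduct.π (fun _ : Fin m => U) i)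
  exact ⟨biproduct.lift h, by apply biproduct.hom_ext; intro j; simp [hh]⟩

lemma univ_epi (U X : RepC k Q) (hU : FinDim U) (hX : X ∈ gen ({U} : Set (RepC k Q))) (hX' : FinDim X) :
    ∃ (n : ℕ) (u : SB U n ⟶ X), Epi u ∧ ∀ g : U ⟶ X, ∃ h : U ⟶ SB U n, h ≫ u = g := by
  obtain ⟨n, u, hu⟩ := univ_map U X hU hX'
  obtain ⟨m, p, hp⟩ := gen_iff.1 hX
  obtain ⟨h, hh⟩ := fact_SB hu p
  exact ⟨n, u, epi_of_epi_fac hh, hu⟩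

lemma pg_epi (X : RepC k Q) (hX : FinDim X) : ∃ (n : ℕ) (u : SB (PG k Q) n ⟶ X), Epi u := by
  obtain ⟨n, u, hu⟩ := univ_map (PG k Q) X pg_fd hX
  refine ⟨n, u, ?_⟩
  rw [Preadditive.epi_iff_cancel_zero]
  intro Z e he
  apply pg_sep
  intro g
  obtain ⟨h, rfl⟩ := hu g
  rw [Category.assoc, he, comp_zero]

end KS

section Supp
variable {C : Type*} [Category C] [Abelian C]

lemma img_desc {X Y Z : C} (g : X ⟶ Y) (p : X ⟶ Z) (h : kernel.ι g ≫ p = 0) :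
    ∃ q : image g ⟶ Z, factorThruImage g ≫ q = p := by
  apply ses_desc (ses_of_epi (factorThruImage g))
  have h1 : kernel.ι (factorThruImage g) ≫ g = 0 := by
    have h2 := kernel.condition_assoc (factorThruImage g) (image.ι g)
    rwa [image.fac, zero_comp] at h2
  rw [← kernel.lift_ι g _ h1, Category.assoc, h, comp_zero]

lemma subq_mono {S M M' : C} (h : IsSubquotient S M) (j : M ⟶ M') [Mono j] : IsSubquotient S M' := by
  obtain ⟨N, i, p, hi, hp⟩ := h
  exact ⟨N, i ≫ j, p, mono_comp _ _, hp⟩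

lemma subq_epi {S M M' : C} (h : IsSubquotient S M) (j : M' ⟶ M) [Epi j] : IsSubquotient S M' := by
  obtain ⟨N, i, p, hi, hp⟩ := h
  exact ⟨pullback j i, pullback.fst j i, pullback.snd j i ≫ p, inferInstance, epi_comp _ _⟩

lemma subq_sum {S A B : C} (hS : Simple S) (h : IsSubquotient S (A ⊞ B)) :
    IsSubquotient S A ∨ IsSubquotient S B := by
  obtain ⟨N, i, p, hi, hp⟩ := h
  by_cases h0 : kernel.ι (i ≫ biprod.snd) ≫ p = 0
  · right
    obtain ⟨q, hq⟩ := img_desc _ _ h0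
    exact ⟨_, image.ι (i ≫ biprod.snd), q, inferInstance, epi_of_epi_fac hq⟩
  · left
    refine ⟨_, kernel.ι (i ≫ biprod.snd) ≫ i ≫ biprod.fst, kernel.ι (i ≫ biprod.snd) ≫ p, ?_,
      epi_of_nonzero_to_simple h0⟩
    rw [Preadditive.mono_iff_cancel_zero]
    intro Z z hz
    have h1 : z ≫ kernel.ι (i ≫ biprod.snd) ≫ i = 0 := by
      apply biprod.hom_ext
      · simpa using hz
      · simp [kernel.condition]
    rw [← cancel_mono (kernel.ι (i ≫ biprod.snd) ≫ i), h1, zero_comp]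

lemma supp_mono {M M' U : C} (h : SuppLE M' U) (j : M ⟶ M') [Mono j] : SuppLE M U :=
  fun S hS h' => h S hS (subq_mono h' j)

lemma supp_epi {M M' U : C} (h : SuppLE M U) (j : M ⟶ M') [Epi j] : SuppLE M' U :=
  fun S hS h' => h S hS (subq_epi h' j)

lemma supp_sum {M M' U : C} (h : SuppLE M U) (h' : SuppLE M' U) : SuppLE (M ⊞ M') U :=
  fun S hS hq => (subq_sum hS hq).elim (h S hS) (h' S hS)

lemma supp_zero {U : C} : SuppLE 0 U := by
  rintro S hS ⟨N, i, p, hi, hp⟩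
  exfalso
  apply Simple.not_isZero S
  have hN : IsZero N := (isZero_zero C).of_mono i
  exact hN.of_epi p

lemma supp_biproduct {U : C} {n : ℕ} (f : Fin n → C) (h : ∀ i, SuppLE (f i) U) : SuppLE (⨁ f) U :=
  biproduct_ind (SuppLE · U) supp_zero (fun _ _ => supp_sum)
    (fun X Y h ⟨i, r, hir⟩ => by
      have : Mono i := mono_of_mono_fac hir
      exact supp_mono h i) f h

lemma supp_gen {U X : C} (h : X ∈ gen ({U} : Set C)) : SuppLE X U := by
  obtain ⟨n, p, hp⟩ := gen_iff.1 h
  exact supp_epi (supp_biproduct _ fun _ => fun S _ h => h) p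

lemma ker_ext {A X D : C} (u : A ⟶ X) [Epi u] (h : Ext1Zero D A)
    (hl : ∀ g : D ⟶ X, ∃ g' : D ⟶ A, g' ≫ u = g) : Ext1Zero D (kernel u) := by
  intro E j p w hS
  obtain ⟨e, he⟩ := ext_ext h j p w hS (kernel.ι u)
  obtain ⟨d, hd⟩ := ses_desc hS (e ≫ u) (by rw [reassoc_of% he, kernel.condition])
  obtain ⟨d', hd'⟩ := hl d
  refine ⟨kernel.lift u (e - p ≫ d') (by simp [hd', hd]), ?_⟩
  rw [← cancel_mono (kernel.ι u)]
  simp [he, reassoc_of% w]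

end Supp

section Torsion
variable {C : Type*} [Category C] [Abelian C] {T : Set C}

lemma tors_biproduct (hT : IsTorsionClass T) {n : ℕ} (f : Fin n → C) (h : ∀ i, f i ∈ T) : (⨁ f) ∈ T :=
  biproduct_ind (· ∈ T) hT.zero_mem (fun _ _ h h' => hT.sum_mem _ h _ h')
    (fun _ _ h h' => hT.summand_mem _ h _ h') f h

lemma extproj_sum (hT : IsTorsionClass T) {X Y : C} (h : ExtProjIn T X) (h' : ExtProjIn T Y) :
    ExtProjIn T (X ⊞ Y) :=
  ⟨hT.sum_mem _ h.1 _ h'.1, fun Z hZ => ext_sum_left (h.2 Z hZ) (h'.2 Z hZ)⟩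

lemma extproj_summand (hT : IsTorsionClass T) {X Y : C} (h : ExtProjIn T X) (h' : IsSummand Y X) :
    ExtProjIn T Y :=
  ⟨hT.summand_mem _ h.1 _ h', fun Z hZ => ext_retract_left (h.2 Z hZ) h'⟩

lemma extproj_biproduct (hT : IsTorsionClass T) {n : ℕ} (f : Fin n → C) (h : ∀ i, ExtProjIn T (f i)) :
    ExtProjIn T (⨁ f) :=
  ⟨tors_biproduct hT f fun i => (h i).1, fun Z hZ => ext_biproduct_left f fun i => (h i).2 Z hZ⟩

/-- left approximation property -/
def LApp (T : Set C) {P M : C} (f : P ⟶ M) : Prop := ∀ X ∈ T, ∀ g : P ⟶ X, ∃ h : M ⟶ X, f ≫ h = g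

lemma coker_extproj (hT : IsTorsionClass T) {P M : C} (f : P ⟶ M) (hf : LApp T f)
    (hM : ExtProjIn T M) : ExtProjIn T (cokernel f) := by
  have hc : cokernel f ∈ T := hT.quot_mem _ hM.1 _ (cokernel.π f) inferInstance
  refine ⟨hc, fun X hX => ext_of_section fun E i p w hS => ?_⟩
  obtain ⟨e, he⟩ := ext_lift (hM.2 X hX) i p w hS (cokernel.π f)
  obtain ⟨t, ht⟩ := ses_lift hS (f ≫ e) (by rw [Category.assoc, he, cokernel.condition])
  obtain ⟨t', rfl⟩ := hf X hX t
  refine ⟨cokernel.desc f (e - t' ≫ i) (by simp [← ht]), ?_⟩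
  rw [← cancel_epi (cokernel.π f)]
  simp [he, w]

lemma LApp.image {P M : C} {f : P ⟶ M} (hf : LApp T f) : LApp T (image.ι f) := by
  intro X hX g
  obtain ⟨h, hh⟩ := hf X hX (factorThruImage f ≫ g)
  refine ⟨h, ?_⟩
  rw [← cancel_epi (factorThruImage f), ← hh, image.fac_assoc]

lemma LApp.pow {P M : C} {f : P ⟶ M} (hf : LApp T f) (n : ℕ) :
    LApp T (biproduct.map (fun _ : Fin n => f)) := by
  intro X hX g
  choose h hh using fun i => hf X hX (biproduct.ι (fun _ : Fin n => P) i ≫ g)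
  exact ⟨biproduct.desc h, by apply biproduct.hom_ext'; intro j; simp [hh]⟩

end Torsion

section Part1

lemma gen_of_fact {M X : RepC k Q} (f : PG k Q ⟶ M) (hX : FinDim X)
    (h : ∀ g : PG k Q ⟶ X, ∃ h : M ⟶ X, f ≫ h = g) : X ∈ gen ({M} : Set (RepC k Q)) := by
  obtain ⟨n, u, hu⟩ := pg_epi X hX
  choose t ht using fun i => h (biproduct.ι (fun _ : Fin n => PG k Q) i ≫ u)
  refine gen_iff.2 ⟨n, biproduct.desc t, ?_⟩
  have : biproduct.map (fun _ : Fin n => f) ≫ biproduct.desc t = u := by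
    apply biproduct.hom_ext'; intro j; simp [ht]
  exact epi_of_epi_fac this

lemma exists_simple_quot (X : RepC k Q) (hX : FinDim X) (h0 : ¬ IsZero X) :
    ∃ (S : RepC k Q) (p : X ⟶ S), Simple S ∧ Epi p := by
  classical
  have hex : ∃ d, ∃ (S : RepC k Q) (p : X ⟶ S), ¬ IsZero S ∧ Epi p ∧ td S = d :=
    ⟨_, X, 𝟙 X, h0, inferInstance, rfl⟩
  obtain ⟨S, p, hS, hp, hd⟩ := Nat.find_spec hex
  have hmin : ∀ (S' : RepC k Q) (p : X ⟶ S'), ¬ IsZero S' → Epi p → td S ≤ td S' := fun S' p h1 h2 => by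
    rw [hd]; exact Nat.find_min' hex ⟨S', p, h1, h2, rfl⟩
  refine ⟨S, p, ⟨fun {Y} f hf => ⟨?_, ?_⟩⟩, hp⟩
  · rintro hi rfl
    apply hS
    have : 𝟙 S = 0 := by rw [← IsIso.inv_hom_id (0 : Y ⟶ S), comp_zero]
    exact (IsZero.iff_id_eq_zero _).2 this
  · intro hne
    by_cases hz : IsZero (cokernel f)
    · have : Epi f := Preadditive.epi_of_isZero_cokernel f hz
      exact isIso_of_mono_of_epi f
    · exfalso
      have h1 := hmin (cokernel f) (p ≫ cokernel.π f) hz (epi_comp _ _)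
      have := iso_of_epi (cokernel.π f) (fd_epi p hX) h1
      apply hne
      rw [← cancel_mono (cokernel.π f), cokernel.condition, zero_comp]

variable {T : Set (RepC k Q)}

lemma exists_T0 (hT : IsTorsionClass T) (hfd : ∀ X ∈ T, FinDim X) (hg : IsFinGen T) :
    ∃ (M : RepC k Q) (f : PG k Q ⟶ M), LApp T f ∧ ExtProjIn T M := by
  classical
  obtain ⟨V, hV, hgen⟩ := hg
  have hex : ∃ d, ∃ M ∈ T, ∃ f : PG k Q ⟶ M, LApp T f ∧ td M = d := by
    obtain ⟨n, u, hu⟩ := univ_map' V (PG k Q) (hfd V hV) pg_fd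
    refine ⟨_, SB V n, tors_biproduct hT _ fun _ => hV, u, ?_, rfl⟩
    intro X hX g
    obtain ⟨m, p, hp⟩ := gen_iff.1 (hgen hX)
    obtain ⟨g', rfl⟩ := pg_lift p g
    obtain ⟨h, rfl⟩ := fact_SB' hu g'
    exact ⟨h ≫ p, by simp⟩
  obtain ⟨M, hM, f, hf, hd⟩ := Nat.find_spec hex
  have hmin : ∀ M' ∈ T, ∀ f' : PG k Q ⟶ M', LApp T f' → td M ≤ td M' := fun M' h1 f' h2 => by
    rw [hd]; exact Nat.find_min' hex ⟨M', h1, f', h2, rfl⟩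
  refine ⟨M, f, hf, hM, fun X hX => ext_of_section fun E i p w hS => ?_⟩
  have hE : E ∈ T := hT.ext_mem _ hS hX hM
  have : Epi p := hS.epi_g
  obtain ⟨l, hl⟩ := pg_lift p f
  obtain ⟨g, rfl⟩ := hf E hE l
  rw [Category.assoc] at hl
  have hI : image (g ≫ p) ∈ T := hT.quot_mem _ hM _ (factorThruImage (g ≫ p)) inferInstance
  have hle : td M ≤ td (image (g ≫ p)) := by
    refine hmin _ hI (f ≫ factorThruImage (g ≫ p)) ?_
    intro Y hY t
    obtain ⟨h, rfl⟩ := hf Y hY t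
    refine ⟨image.ι (g ≫ p) ≫ h, ?_⟩
    rw [Category.assoc, image.fac_assoc, ← Category.assoc, hl]
  have i1 := iso_of_epi (factorThruImage (g ≫ p)) (hfd M hM) hle
  have i2 := iso_of_mono (image.ι (g ≫ p)) (hfd M hM) hle
  have i3 : IsIso (g ≫ p) := by
    rw [← image.fac (g ≫ p)]; infer_instance
  exact ⟨inv (g ≫ p) ≫ g, by rw [Category.assoc, IsIso.inv_hom_id]⟩

lemma exists_C (hT : IsTorsionClass T) (hfd : ∀ X ∈ T, FinDim X) (hg : IsFinGen T) :
    ∃ D : RepC k Q, ExtProjIn T D ∧ ∀ X, ExtProjIn T X → X ∈ addSet ({D} : Set (RepC k Q)) := by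
  obtain ⟨M, f, hf, hM⟩ := exists_T0 hT hfd hg
  have hM2 := coker_extproj hT (image.ι f) hf.image hM
  have hD := extproj_sum hT hM hM2
  refine ⟨_, hD, fun X hX => ?_⟩
  have hMg : ∀ {X}, X ∈ T → X ∈ gen ({M} : Set (RepC k Q)) := fun {X} hX =>
    gen_of_fact f (hfd X hX) (hf X hX)
  have hXg : X ∈ gen ({M ⊞ cokernel (image.ι f)} : Set (RepC k Q)) :=
    gen_trans (hMg hX.1) (gen_add (add_summand (add_self _) (summand_inl _ _)))
  obtain ⟨n, u, hu, hfac⟩ := univ_epi _ X (hfd _ hD.1) hXg (hfd _ hX.1)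
  have hA : SB (M ⊞ cokernel (image.ι f)) n ∈ T := tors_biproduct hT _ fun _ => hD.1
  have hK : Ext1Zero (M ⊞ cokernel (image.ι f)) (kernel u) := ker_ext u (hD.2 _ hA) hfac
  have hK2 : Ext1Zero (cokernel (image.ι f)) (kernel u) := ext_retract_left hK (summand_inr _ _)
  have hKg : kernel u ∈ gen ({M} : Set (RepC k Q)) := by
    refine gen_of_fact f (fd_mono (kernel.ι u) (hfd _ hA)) fun g => ?_
    obtain ⟨h, hh⟩ := hf _ hA (g ≫ kernel.ι u)
    obtain ⟨q, hq⟩ := img_desc f g (by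
      rw [← cancel_mono (kernel.ι u), Category.assoc, ← hh, kernel.condition_assoc, zero_comp, zero_comp])
    obtain ⟨e, he⟩ := ext_ext hK2 _ _ _ (ses_of_mono (image.ι f)) q
    exact ⟨e, by rw [← hq, ← he, image.fac_assoc]⟩
  have hKT : kernel u ∈ T := by
    obtain ⟨m, p, hp⟩ := gen_iff.1 hKg
    exact hT.quot_mem _ (tors_biproduct hT (fun _ : Fin m => M) fun _ => hM.1) _ p hp
  obtain ⟨s, hs⟩ := ext_section (hX.2 _ hKT) _ _ _ _ (ses_of_epi u)
  exact add_iff.2 ⟨n, s, u, hs⟩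

lemma part1_exists (hT : IsTorsionClass T) (hfd : ∀ X ∈ T, FinDim X) (hg : IsFinGen T) :
    ∃ U : RepC k Q, IsExtProjSum T U := by
  obtain ⟨D, hD, hall⟩ := exists_C hT hfd hg
  obtain ⟨n, f, h1, h2, h3⟩ := indec_list D (hfd D hD.1)
  refine ⟨⨁ f, n, f, fun i => ⟨(h1 i).1, extproj_summand hT hD (h1 i).2⟩, h2, ?_, ⟨Iso.refl _⟩⟩
  intro P hP hE
  obtain ⟨m, hm⟩ := add_iff.1 (hall P hE)
  obtain ⟨_, hi⟩ := indec_biproduct hP (hfd P hE.1) _ hm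
  exact h3 P hP hi

lemma part1_gen (hT : IsTorsionClass T) (hfd : ∀ X ∈ T, FinDim X) (hg : IsFinGen T)
    (U : RepC k Q) (hU : IsExtProjSum T U) :
    IsBasic U ∧ IsSupportTilting U ∧ gen ({U} : Set (RepC k Q)) = T := by
  obtain ⟨n, f, h1, h2, h3, ⟨e⟩⟩ := hU
  have hUE : ExtProjIn T U :=
    extproj_summand hT (extproj_biproduct hT f fun i => (h1 i).2) (IsSummand.of_iso e)
  have hadd : ∀ X, ExtProjIn T X → X ∈ addSet ({U} : Set (RepC k Q)) := fun X hX => by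
    refine add_of_indec X (hfd X hX.1) fun Y hY hs => ?_
    obtain ⟨i, ⟨e'⟩⟩ := h3 Y hY (extproj_summand hT hX hs)
    exact add_summand (add_self U) (((IsSummand.of_iso e').trans (summand_biproduct f i)).trans
      (IsSummand.of_iso e.symm))
  obtain ⟨M, t, ht, hM⟩ := exists_T0 hT hfd hg
  have hgen : ∀ X ∈ T, X ∈ gen ({U} : Set (RepC k Q)) := fun X hX =>
    gen_trans (gen_of_fact t (hfd X hX) (ht X hX)) (gen_add (hadd M hM))
  refine ⟨⟨n, f, fun i => (h1 i).1, h2, ⟨e⟩⟩, ⟨hUE.2 U hUE.1, ⟨hfd U hUE.1, fun S _ h => h⟩,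
    hUE.2 U hUE.1, ?_⟩, ?_⟩
  · rintro P ⟨⟨hP1, hP2⟩, hP3⟩
    obtain ⟨n, w, hw⟩ := pg_epi P hP1
    have hMn : ExtProjIn T (SB M n) := extproj_biproduct hT _ fun _ => hM
    let F : SB (PG k Q) n ⟶ SB M n := biproduct.map (fun _ : Fin n => t)
    have hF : LApp T F := ht.pow n
    have hK : HomZero (kernel (factorThruImage F)) U := by
      intro g
      have hI : Ext1Zero (image F) U := ext_mono (hMn.2 U hUE.1) (image.ι F)
      obtain ⟨e, he⟩ := ext_ext hI _ _ _ (ses_of_epi (factorThruImage F)) g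
      obtain ⟨h, hh⟩ := hF U hUE.1 e
      rw [← he, ← hh]
      have h2 := kernel.condition_assoc (factorThruImage F) (image.ι F ≫ h)
      rwa [image.fac_assoc, zero_comp] at h2
    have hKw : kernel.ι (factorThruImage F) ≫ w = 0 := by
      by_contra hne
      have hnz : ¬ IsZero (image (kernel.ι (factorThruImage F) ≫ w)) := fun hz => hne (by
        rw [← image.fac (kernel.ι (factorThruImage F) ≫ w), hz.eq_of_src (image.ι _) 0, comp_zero])
      obtain ⟨S, σ, hS, hσ⟩ := exists_simple_quot _
        (fd_mono (image.ι (kernel.ι (factorThruImage F) ≫ w)) hP1) hnz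
      obtain ⟨N, i, p, hi, hp⟩ := hP2 S hS ⟨_, image.ι (kernel.ι (factorThruImage F) ≫ w), σ, inferInstance, hσ⟩
      have hKp : ∀ X, Ext1Zero (kernel (factorThruImage F)) X := fun X =>
        ext_mono (ext_biproduct_left (fun _ : Fin n => PG k Q) fun _ => pg_ext_zero X) (kernel.ι (factorThruImage F))
      obtain ⟨e, he⟩ := ext_lift (hKp _) _ _ _ (ses_of_epi p)
        (factorThruImage (kernel.ι (factorThruImage F) ≫ w) ≫ σ)
      have he0 : e = 0 := by rw [← cancel_mono i, hK (e ≫ i), zero_comp]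
      rw [he0, zero_comp] at he
      apply Simple.not_isZero S
      have hep : Epi (factorThruImage (kernel.ι (factorThruImage F) ≫ w) ≫ σ) := epi_comp _ _
      rw [← he] at hep
      rw [IsZero.iff_id_eq_zero, ← cancel_epi (0 : kernel (factorThruImage F) ⟶ S), zero_comp, comp_zero]
    obtain ⟨q, hq⟩ := ses_desc (ses_of_epi (factorThruImage F)) w hKw
    have hqe : Epi q := epi_of_epi_fac hq
    obtain ⟨s, hs⟩ := hP3 (image F) ⟨fd_mono (image.ι F) (hfd _ hMn.1),
      supp_mono (supp_gen (hgen _ hMn.1)) (image.ι F)⟩ q hqe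
    have hsm : Mono s := mono_of_mono_fac hs
    have hj : LApp T (s ≫ image.ι F) := by
      intro X hX g
      obtain ⟨h, hh⟩ := hF.image X hX (q ≫ g)
      exact ⟨h, by rw [Category.assoc, hh, ← Category.assoc, hs, Category.id_comp]⟩
    exact ⟨SB M n, cokernel (s ≫ image.ι F), hadd _ hMn, hadd _ (coker_extproj hT _ hj hMn), _, _, _,
      ses_of_mono (s ≫ image.ι F)⟩
  · ext X
    refine ⟨fun h => ?_, hgen X⟩
    obtain ⟨m, p, hp⟩ := gen_iff.1 h
    exact hT.quot_mem _ (tors_biproduct hT (fun _ : Fin m => U) fun _ => hUE.1) _ p hp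

end Part1

section Part2

lemma split_cover (U K : RepC k Q) (hK : FinDim K) (hs : SuppLE K U) :
    ∃ (R : RepC k Q) (r : R ⟶ K), Epi r ∧ SplitProjIn { M : RepC k Q | FinDim M ∧ SuppLE M U } R := by
  classical
  obtain ⟨n, w, hw⟩ := pg_epi K hK
  have hP : FinDim (SB (PG k Q) n) := fd_biproduct _ fun _ => pg_fd
  have hex : ∃ d, ∃ (R : RepC k Q) (q : SB (PG k Q) n ⟶ R), Epi q ∧ SuppLE R U ∧
      td (SB (PG k Q) n) - td R = d := ⟨_, K, w, hw, hs, rfl⟩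
  obtain ⟨R, q, hq, hR, hd⟩ := Nat.find_spec hex
  have hRf : FinDim R := fd_epi q hP
  have hmax : ∀ (R' : RepC k Q) (q' : SB (PG k Q) n ⟶ R'), Epi q' → SuppLE R' U → td R' ≤ td R := by
    intro R' q' h1 h2
    have h3 := Nat.find_min' hex ⟨R', q', h1, h2, rfl⟩
    rw [← hd] at h3
    have h4 := td_epi q' hP
    have h5 := td_epi q hP
    omega
  have hfac : ∀ X : RepC k Q, FinDim X → SuppLE X U → ∀ g : SB (PG k Q) n ⟶ X, ∃ h : R ⟶ X, q ≫ h = g := by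
    intro X hX hXs g
    have h1 := hmax (image (biprod.lift q g)) (factorThruImage _) inferInstance
      (supp_mono (supp_sum hR hXs) (image.ι (biprod.lift q g)))
    have h2 : factorThruImage (biprod.lift q g) ≫ image.ι (biprod.lift q g) ≫ biprod.fst = q := by
      rw [image.fac_assoc, biprod.lift_fst]
    have h3 : Epi (image.ι (biprod.lift q g) ≫ biprod.fst) := epi_of_epi_fac h2
    have h4 := iso_of_epi (image.ι (biprod.lift q g) ≫ biprod.fst)
      (fd_epi (factorThruImage (biprod.lift q g)) hP) h1
    refine ⟨inv (image.ι (biprod.lift q g) ≫ biprod.fst) ≫ image.ι (biprod.lift q g) ≫ biprod.snd, ?_⟩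
    have h5 : q ≫ inv (image.ι (biprod.lift q g) ≫ biprod.fst) = factorThruImage (biprod.lift q g) := by
      rw [IsIso.comp_inv_eq, h2]
    rw [reassoc_of% h5, image.fac_assoc, biprod.lift_snd]
  obtain ⟨r, hr⟩ := hfac K hK hs w
  refine ⟨R, r, epi_of_epi_fac hr, ⟨hRf, hR⟩, ?_⟩
  rintro X ⟨hX, hXs⟩ p hp
  obtain ⟨l, hl⟩ := fact_SB (fun g => pg_lift p g) q
  obtain ⟨s, rfl⟩ := hfac X hX hXs l
  exact ⟨s, by rw [← cancel_epi q, ← Category.assoc, hl, Category.comp_id]⟩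

lemma ext_gen {U X : RepC k Q} (hU : Ext1Zero U U) (hX : X ∈ gen ({U} : Set (RepC k Q))) :
    Ext1Zero U X := by
  obtain ⟨n, p, hp⟩ := gen_iff.1 hX
  exact ext_epi (ext_biproduct_right _ fun _ => hU) p

lemma gen_torsion_s3 {U : RepC k Q} (hU : Ext1Zero U U) : IsTorsionClass (gen ({U} : Set (RepC k Q))) where
  zero_mem := gen_add (add_zero' (isZero_zero _))
  sum_mem _ h _ h' := gen_sum h h'
  summand_mem _ h _ h' := gen_summand h h'
  quot_mem _ h _ p hp := gen_epi h p
  ext_mem := by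
    rintro ⟨i, p, w⟩ hS h1 h3
    dsimp only at h1 h3 ⊢
    obtain ⟨n, a, ha⟩ := gen_iff.1 h1
    obtain ⟨m, b, hb⟩ := gen_iff.1 h3
    have hE := ext_gen hU h1
    obtain ⟨e, he⟩ := ext_lift (ext_biproduct_left (fun _ : Fin m => U) fun _ => hE) i p w hS b
    have hep : Epi (biprod.desc (a ≫ i) e) := by
      rw [Preadditive.epi_iff_cancel_zero]
      intro Z z hz
      have z1 : a ≫ i ≫ z = 0 := by
        have := congrArg (fun t => biprod.inl ≫ t) hz
        simpa using this
      have z2 : e ≫ z = 0 := by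
        have := congrArg (fun t => biprod.inr ≫ t) hz
        simpa using this
      obtain ⟨z', rfl⟩ := ses_desc hS z (by rw [← cancel_epi a, z1, comp_zero])
      rw [← Category.assoc, he] at z2
      rw [show z' = 0 by rw [← cancel_epi b, z2, comp_zero], comp_zero]
    exact ⟨_, add_sum (add_iff.2 ⟨n, IsSummand.refl _⟩) (add_iff.2 ⟨m, IsSummand.refl _⟩), _, hep⟩

lemma part2 (U : RepC k Q) (hf : FinDim U) (hb : IsBasic U) (hst : IsSupportTilting U) :
    IsTorsionClass (gen ({U} : Set (RepC k Q))) ∧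
      (∀ X ∈ gen ({U} : Set (RepC k Q)), FinDim X) ∧
      IsFinGen (gen ({U} : Set (RepC k Q))) ∧
      IsExtProjSum (gen ({U} : Set (RepC k Q))) U := by
  have hE : Ext1Zero U U := hst.1
  have hT := gen_torsion_s3 hE
  have hfd : ∀ X ∈ gen ({U} : Set (RepC k Q)), FinDim X := fun X hX => by
    obtain ⟨n, p, hp⟩ := gen_iff.1 hX
    exact fd_epi p (fd_biproduct _ fun _ => hf)
  have hUg : U ∈ gen ({U} : Set (RepC k Q)) := gen_add (add_self U)
  have hUE : ExtProjIn (gen ({U} : Set (RepC k Q))) U := ⟨hUg, fun X hX => ext_gen hE hX⟩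
  refine ⟨hT, hfd, ⟨U, hUg, fun _ h => h⟩, ?_⟩
  obtain ⟨n, f, h1, h2, ⟨e⟩⟩ := hb
  refine ⟨n, f, fun i => ⟨h1 i, extproj_summand hT hUE
    ((summand_biproduct f i).trans (IsSummand.of_iso e.symm))⟩, h2, ?_, ⟨e⟩⟩
  intro P hP hPE
  obtain ⟨m, u, hu, hfac⟩ := univ_epi U P hf hPE.1 (hfd P hPE.1)
  have hA : SB U m ∈ gen ({U} : Set (RepC k Q)) := gen_biproduct _ fun _ => hUg
  have hK : Ext1Zero U (kernel u) := ker_ext u (ext_gen hE hA) hfac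
  obtain ⟨R, r, hr, hR⟩ := split_cover U (kernel u) (fd_mono (kernel.ι u) (hfd _ hA))
    (supp_mono (supp_gen hA) (kernel.ι u))
  obtain ⟨T', T'', hT', hT'', i, p, w, hS⟩ := hst.2.2.2 R hR
  obtain ⟨g, hg⟩ := ext_ext (ext_add_left hK hT'') i p w hS r
  have hge : Epi g := epi_of_epi_fac hg
  have hKg : kernel u ∈ gen ({U} : Set (RepC k Q)) := ⟨T', hT', g, hge⟩
  obtain ⟨s, hs⟩ := ext_section (hPE.2 _ hKg) _ _ _ _ (ses_of_epi u)
  obtain ⟨_, hi⟩ := indec_biproduct hP (hfd P hPE.1) _ ⟨s, u, hs⟩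
  obtain ⟨i, hi⟩ := indec_biproduct hP (hfd P hPE.1) f (hi.trans (IsSummand.of_iso e))
  exact ⟨i, indec_iso_of_summand (h1 i) hP hi⟩

lemma part3 (U U' : RepC k Q) (T : Set (RepC k Q)) (h : IsExtProjSum T U) (h' : IsExtProjSum T U') :
    Nonempty (U ≅ U') := by
  obtain ⟨n, f, h1, h2, h3, ⟨e⟩⟩ := h
  obtain ⟨m, g, h1', h2', h3', ⟨e'⟩⟩ := h'
  obtain ⟨t⟩ := list_iso f g h2 h2' (fun i => h3' _ (h1 i).1 (h1 i).2) (fun i => h3 _ (h1' i).1 (h1' i).2)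
  exact ⟨e ≪≫ t ≪≫ e'.symm⟩

end Part2

/-- For a finite acyclic quiver `Q`, the assignment sending a finitely
generated torsion class `T` to the direct sum of one representative of each isomorphism
class of indecomposable Ext-projective objects of `T`, and the assignment
`C ↦ Gen C`, are mutually inverse bijections between finitely generated torsion classes
in `rep Q` and isomorphism classes of basic support tilting modules. -/
theorem statement3 (k : Type) [Field k] [IsAlgClosed k] (Q : FinQuiver) :
    (∀ T : Set (RepC k Q), IsTorsionClass T → (∀ X ∈ T, FinDim X) → IsFinGen T →
      (∃ U : RepC k Q, IsExtProjSum T U) ∧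
        ∀ U : RepC k Q, IsExtProjSum T U →
          IsBasic U ∧ IsSupportTilting U ∧ gen ({U} : Set (RepC k Q)) = T) ∧
    (∀ U : RepC k Q, FinDim U → IsBasic U → IsSupportTilting U →
      IsTorsionClass (gen ({U} : Set (RepC k Q))) ∧
      (∀ X ∈ gen ({U} : Set (RepC k Q)), FinDim X) ∧
      IsFinGen (gen ({U} : Set (RepC k Q))) ∧
      IsExtProjSum (gen ({U} : Set (RepC k Q))) U) ∧
    (∀ U U' : RepC k Q, FinDim U → FinDim U' → IsBasic U → IsBasic U' →
      IsSupportTilting U → IsSupportTilting U' →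
      gen ({U} : Set (RepC k Q)) = gen ({U'} : Set (RepC k Q)) →
      Nonempty (U ≅ U')) := by
  refine ⟨fun T hT hfd hg => ⟨part1_exists hT hfd hg, fun U hU => part1_gen hT hfd hg U hU⟩,
    fun U hf hb hst => part2 U hf hb hst, ?_⟩
  intro U U' hf hf' hb hb' hst hst' hEq
  have h1 := (part2 U hf hb hst).2.2.2
  have h2 := (part2 U' hf' hb' hst').2.2.2
  rw [← hEq] at h2
  exact part3 U U' _ h1 h2

end Statement3
end NCPaper
end
end

section
/- For any torsion class T in rep Q, the subcategory a(T) consisting of all objects B ∈ T such that every morphism g : Y → B with Y ∈ T has kernel in T, is a wide subcategory of rep Q (closed under kernels, cokernels and extensions). -/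
open CategoryTheory CategoryTheory.Limits ZeroObject

attribute [local instance] CategoryTheory.Abelian.hasFiniteBiproducts

noncomputable section

namespace NCPaper

variable (k : Type) [Field k] (Q : FinQuiver)

variable {k Q}

section Aux

variable {C : Type*} [Category C] [Abelian C]

lemma torsion_iso {T : Set C} (hT : IsTorsionClass T) {X Y : C} (e : X ≅ Y) (h : X ∈ T) : Y ∈ T :=
  hT.quot_mem X h Y e.hom inferInstance

lemma aSet_mono {T : Set C} (hT : IsTorsionClass T) {X Y : C} (i : X ⟶ Y) [Mono i]
    (hX : X ∈ T) (hY : Y ∈ aSet T) : X ∈ aSet T :=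
  ⟨hX, fun Z hZ g => torsion_iso hT (kernelCompMono g i) (hY.2 Z hZ (g ≫ i))⟩

/-- kernel of an object-level fork characterization -/
lemma torsion_of_isLimit {T : Set C} (hT : IsTorsionClass T) {X Y K : C} (f : X ⟶ Y)
    (i : K ⟶ X) [Mono i] (w : i ≫ f = 0)
    (hl : ∀ {Z : C} (t : Z ⟶ X), t ≫ f = 0 → ∃ l : Z ⟶ K, l ≫ i = t) (hK : K ∈ T) :
    kernel f ∈ T := by
  obtain ⟨l, h⟩ := hl (kernel.ι f) (by simp)
  refine torsion_iso hT (X := K) ⟨kernel.lift f i w, l, ?_, ?_⟩ hK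
  · rw [← cancel_mono i]; simp [h]
  · rw [← cancel_mono (kernel.ι f)]; simp [h]

lemma aSet_ext {T : Set C} (hT : IsTorsionClass T) (S : ShortComplex C) (hS : S.ShortExact)
    (h₁ : S.X₁ ∈ aSet T) (h₃ : S.X₃ ∈ aSet T) : S.X₂ ∈ aSet T := by
  refine ⟨hT.ext_mem S hS h₁.1 h₃.1, fun Y hY g => ?_⟩
  have := hS.mono_f
  have hK := h₃.2 Y hY (g ≫ S.g)
  let m : kernel (g ≫ S.g) ⟶ S.X₁ := hS.exact.lift (kernel.ι (g ≫ S.g) ≫ g) (by simp)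
  have hm : m ≫ S.f = kernel.ι (g ≫ S.g) ≫ g := hS.exact.lift_f _ _
  refine torsion_of_isLimit hT g (kernel.ι m ≫ kernel.ι (g ≫ S.g)) ?_ ?_ (h₁.2 _ hK m)
  · rw [Category.assoc, ← hm]; simp
  · intro Z t ht
    have w : t ≫ g ≫ S.g = 0 := by rw [← Category.assoc, ht, zero_comp]
    have w' : kernel.lift (g ≫ S.g) t w ≫ m = 0 := by
      rw [← cancel_mono S.f, Category.assoc, hm, kernel.lift_ι_assoc, ht, zero_comp]
    exact ⟨kernel.lift m (kernel.lift (g ≫ S.g) t w) w', by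
      rw [kernel.lift_ι_assoc, kernel.lift_ι]⟩

lemma aSet_coker {T : Set C} (hT : IsTorsionClass T) {A B : C} (hA : A ∈ aSet T)
    (hB : B ∈ aSet T) (f : A ⟶ B) : cokernel f ∈ aSet T := by
  refine ⟨hT.quot_mem B hB.1 _ (cokernel.π f) inferInstance, fun Y hY g => ?_⟩
  have hI : kernel (cokernel.π f) ∈ T :=
    hT.quot_mem A hA.1 _ (Abelian.factorThruImage f) inferInstance
  let j : kernel (cokernel.π f) ⟶ pullback g (cokernel.π f) :=
    pullback.lift 0 (kernel.ι _) (by simp)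
  have hj1 : j ≫ pullback.fst _ _ = 0 := pullback.lift_fst _ _ _
  have hj2 : j ≫ pullback.snd _ _ = kernel.ι _ := pullback.lift_snd _ _ _
  have : Mono j := by
    have : Mono (j ≫ pullback.snd g (cokernel.π f)) := by rw [hj2]; infer_instance
    exact mono_of_mono j (pullback.snd g (cokernel.π f))
  have hP : pullback g (cokernel.π f) ∈ T := by
    refine hT.ext_mem (ShortComplex.mk j (pullback.fst _ _) hj1)
      (ShortComplex.ShortExact.mk' (ShortComplex.exact_of_f_is_kernel _ ?_) ‹_›
        (inferInstanceAs (Epi (pullback.fst g (cokernel.π f))))) hI hY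
    refine KernelFork.IsLimit.ofι' _ _ fun {Z} t ht => ⟨kernel.lift _ (t ≫ pullback.snd _ _) ?_, ?_⟩
    · dsimp at ht
      rw [Category.assoc, ← pullback.condition, ← Category.assoc, ht, zero_comp]
    · dsimp at ht ⊢
      apply pullback.hom_ext
      · rw [Category.assoc, hj1, comp_zero]; exact ht.symm
      · rw [Category.assoc, hj2, kernel.lift_ι]
  have hK := hB.2 _ hP (pullback.snd g (cokernel.π f))
  have hm : Mono (kernel.ι (pullback.snd g (cokernel.π f)) ≫ pullback.fst g (cokernel.π f)) := by
    refine Preadditive.mono_of_cancel_zero _ fun t ht => ?_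
    rw [← cancel_mono (kernel.ι _)]
    apply pullback.hom_ext
    · simpa using ht
    · simp
  refine torsion_of_isLimit hT g (kernel.ι (pullback.snd g (cokernel.π f)) ≫ pullback.fst _ _)
    ?_ ?_ hK
  · rw [Category.assoc, pullback.condition, ← Category.assoc, kernel.condition, zero_comp]
  · intro Z t ht
    have w : t ≫ g = (0 : Z ⟶ B) ≫ cokernel.π f := by rw [ht, zero_comp]
    refine ⟨kernel.lift _ (pullback.lift t 0 w) (pullback.lift_snd _ _ _), ?_⟩
    rw [kernel.lift_ι_assoc]
    exact pullback.lift_fst _ _ _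

lemma aSet_wide {T : Set C} (hT : IsTorsionClass T) : IsWide (aSet T) where
  zero_mem := ⟨hT.zero_mem, fun Y hY g =>
    torsion_of_isLimit hT g (𝟙 Y) ((isZero_zero C).eq_of_tgt _ _) (fun t _ => ⟨t, by simp⟩) hY⟩
  sum_mem X hX Y hY := aSet_ext hT (ShortComplex.mk (biprod.inl : X ⟶ X ⊞ Y) biprod.snd (by simp))
    (ShortComplex.Splitting.ofHasBinaryBiproduct X Y).shortExact hX hY
  summand_mem X hX Y h := by
    obtain ⟨i, r, hir⟩ := h
    have : Mono i := by
      have : Mono (i ≫ r) := by rw [hir]; infer_instance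
      exact mono_of_mono i r
    exact aSet_mono hT i (hT.summand_mem X hX.1 Y ⟨i, r, hir⟩) hX
  ker_mem X hX Y hY f := aSet_mono hT (kernel.ι f) (hY.2 X hX.1 f) hX
  coker_mem X hX Y hY f := aSet_coker hT hX hY f
  ext_mem S hS h₁ h₃ := aSet_ext hT S hS h₁ h₃

end Aux

section Statement4

/-- For any torsion class `T` in `rep Q`, the subcategory `a(T)`
consisting of all objects `B ∈ T` such that every morphism `g : Y ⟶ B` with `Y ∈ T`
has kernel in `T`, is a wide subcategory of `rep Q` (in particular it is closed under
kernels, cokernels and extensions). -/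
theorem statement4 (k : Type) [Field k] [IsAlgClosed k] (Q : FinQuiver)
    (T : Set (RepC k Q)) (hT : IsTorsionClass T) (hfd : ∀ X ∈ T, FinDim X) :
    IsWide (aSet T) := by
  exact aSet_wide hT

end Statement4
end NCPaper
end
end
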